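/- arXiv:1505.00686 — 3 statements merged into one kernel-verified Lean document; each statement's English description precedes it below -/
import Mathlib

section
/- Let R > 0 and let g : D_{2R}(0) → ℂ be an injective holomorphic function on the open disk of radius 2R centered at 0, with g(0) = 0 and 0 < |g′(0)| < 1/17. Then g(D_R(0)) ⊆ D_R(0), and for any two bounded holomorphic functions φ₁, φ₂ : D_R(0) → ℂ with φ₁(0) = φ₂(0) = 0 and φ₁′(0) = φ₂′(0) = 1, one has sup_{|z|<R} |g′(0)|^{-1}·|φ₁(g(z)) − φ₂(g(z))| ≤ (16/17)·sup_{|z|<R} |φ₁(z) − φ₂(z)|. -/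
open Metric Set

namespace UnivalentDistortion

open MeasureTheory Filter Topology Complex ComplexConjugate

theorem le_circleAverage_normSq_sub_inv_sq {k : ℂ → ℂ} (hk : DifferentiableOn ℂ k (ball 0 1))
    {s : ℝ} (hs : 0 < s) (hs1 : s < 1) :
    (s ^ 4)⁻¹ + ‖k 0‖ ^ 2 ≤ Real.circleAverage (fun z ↦ ‖k z - (z ^ 2)⁻¹‖ ^ 2) 0 s := by
  set G : ℂ → ℂ := fun z ↦ 2 * conj (k 0) * k z - 2 * (s ^ 4 : ℂ)⁻¹ * z ^ 2 * k z
    + ((s ^ 4)⁻¹ - ‖k 0‖ ^ 2 : ℝ) with hG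
  have hGd : DifferentiableOn ℂ G (ball 0 1) := by
    simp only [hG]; fun_prop
  have hsub : closedBall (0 : ℂ) |s| ⊆ ball 0 1 := by
    rw [abs_of_pos hs]; exact closedBall_subset_ball hs1
  have hsph : sphere (0 : ℂ) |s| ⊆ ball 0 1 := sphere_subset_closedBall.trans hsub
  have hGi : CircleIntegrable G 0 s := (hGd.continuousOn.mono hsph).circleIntegrable'
  have hGm : Real.circleAverage G 0 s = G 0 :=
    (hGd.mono hsub).diffContOnCl_ball (subset_refl _) |>.circleAverage
  have hre : Real.circleAverage (fun z ↦ (G z).re) 0 s = (G 0).re := by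
    rw [← hGm]
    exact (Complex.reCLM.circleAverage_comp_comm hGi)
  have hG0 : (G 0).re = (s ^ 4)⁻¹ + ‖k 0‖ ^ 2 := by
    have : G 0 = (((s ^ 4)⁻¹ + ‖k 0‖ ^ 2 : ℝ) : ℂ) := by
      simp only [hG]
      rw [mul_assoc, mul_comm (conj (k 0)), Complex.mul_conj, Complex.normSq_eq_norm_sq]
      push_cast; ring
    rw [this, Complex.ofReal_re]
  rw [← hG0, ← hre]
  have hne : ∀ z ∈ sphere (0 : ℂ) |s|, z ≠ 0 := by
    rintro z hz rfl
    simp [eq_comm, hs.ne'] at hz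
  apply Real.circleAverage_mono
  · exact ContinuousOn.circleIntegrable' (Complex.continuous_re.comp_continuousOn
      (hGd.continuousOn.mono hsph))
  · apply ContinuousOn.circleIntegrable'
    have := hk.continuousOn.mono hsph
    have h2 : ContinuousOn (fun z : ℂ ↦ (z ^ 2)⁻¹) (sphere 0 |s|) :=
      ContinuousOn.inv₀ (by fun_prop) fun z hz ↦ pow_ne_zero 2 (hne z hz)
    fun_prop
  · intro z hz
    have hzs : ‖z‖ = s := by simpa [abs_of_pos hs] using hz
    have hz0 := hne z hz
    have hinv : (z ^ 2)⁻¹ = conj (z ^ 2) * ((s ^ 4)⁻¹ : ℝ) := by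
      rw [Complex.inv_def, Complex.normSq_eq_norm_sq, norm_pow, hzs]
      norm_num [← pow_mul]
    have hn : ‖(z ^ 2)⁻¹‖ ^ 2 = (s ^ 4)⁻¹ := by
      rw [norm_inv, norm_pow, hzs]; ring
    have h1 : ‖k z - (z ^ 2)⁻¹‖ ^ 2
        = ‖k z‖ ^ 2 - 2 * (s ^ 4)⁻¹ * (z ^ 2 * k z).re + (s ^ 4)⁻¹ := by
      rw [← hn, ← Complex.normSq_eq_norm_sq, Complex.normSq_sub, Complex.normSq_eq_norm_sq,
        Complex.normSq_eq_norm_sq, hn, hinv, map_mul, Complex.conj_conj, Complex.conj_ofReal]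
      have : (k z * (z ^ 2 * ((s ^ 4)⁻¹ : ℝ))).re = (s ^ 4)⁻¹ * (z ^ 2 * k z).re := by
        rw [← Complex.re_ofReal_mul]; congr 1; ring
      rw [this]; ring
    have h2 : ‖k z‖ ^ 2 - 2 * (conj (k 0) * k z).re + ‖k 0‖ ^ 2 = ‖k z - k 0‖ ^ 2 := by
      rw [← Complex.normSq_eq_norm_sq (k z - k 0), Complex.normSq_sub, Complex.normSq_eq_norm_sq,
        Complex.normSq_eq_norm_sq, mul_comm (k z)]; ring
    have h3 : (G z).re = 2 * (conj (k 0) * k z).re - 2 * (s ^ 4)⁻¹ * (z ^ 2 * k z).re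
        + ((s ^ 4)⁻¹ - ‖k 0‖ ^ 2) := by
      have : G z = ((2 : ℝ) : ℂ) * (conj (k 0) * k z)
        - ((2 * (s ^ 4)⁻¹ : ℝ) : ℂ) * (z ^ 2 * k z) + ((s ^ 4)⁻¹ - ‖k 0‖ ^ 2 : ℝ) := by
        simp only [hG]; push_cast; ring
      rw [this, Complex.add_re, Complex.sub_re, Complex.re_ofReal_mul, Complex.re_ofReal_mul,
        Complex.ofReal_re]
    rw [h1, h3]
    nlinarith [sq_nonneg ‖k z - k 0‖]

theorem ofReal_integral_le_lintegral_annulus {φ : ℂ → ℝ} (hφ : Measurable φ) (h0 : ∀ z, 0 ≤ φ z)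
    {c : ℝ → ℝ} {r ρ : ℝ} (hr : 0 < r) (hrρ : r ≤ ρ) (hc : ContinuousOn c (Icc r ρ))
    (hc0 : ∀ s ∈ Icc r ρ, 0 ≤ c s)
    (hi : ∀ s ∈ Ioo r ρ, CircleIntegrable φ 0 s)
    (hle : ∀ s ∈ Ioo r ρ, c s ≤ Real.circleAverage φ 0 s) :
    ENNReal.ofReal (∫ s in r..ρ, 2 * Real.pi * (s * c s)) ≤
      ∫⁻ z in {z : ℂ | r < ‖z‖ ∧ ‖z‖ < ρ}, ENNReal.ofReal (φ z) := by
  have hA : MeasurableSet {z : ℂ | r < ‖z‖ ∧ ‖z‖ < ρ} :=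
    (measurableSet_lt measurable_const measurable_norm).inter
      (measurableSet_lt measurable_norm measurable_const)
  have hsymm : ∀ p : ℝ × ℝ, Complex.polarCoord.symm p = circleMap 0 p.1 p.2 := fun p ↦ by
    simp [Complex.polarCoord_symm_apply, circleMap, Complex.exp_mul_I]
  have hmeas : Measurable fun p : ℝ × ℝ ↦ ENNReal.ofReal p.1 •
      {z : ℂ | r < ‖z‖ ∧ ‖z‖ < ρ}.indicator (fun z ↦ ENNReal.ofReal (φ z))
        (Complex.polarCoord.symm p) := by
    simp only [hsymm, smul_eq_mul]
    have h1 : Measurable fun p : ℝ × ℝ ↦ circleMap 0 p.1 p.2 :=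
      Real.circleMap.continuous.measurable
    exact (measurable_fst.ennreal_ofReal).mul ((hφ.ennreal_ofReal.indicator hA).comp h1)
  rw [← lintegral_indicator hA, ← Complex.lintegral_comp_polarCoord_symm,
    polarCoord_target, Measure.volume_eq_prod, setLIntegral_prod _ hmeas.aemeasurable]
  have hcont : ContinuousOn (fun s ↦ 2 * Real.pi * (s * c s)) (Icc r ρ) := by fun_prop
  rw [intervalIntegral.integral_of_le hrρ, integral_Ioc_eq_integral_Ioo,
    ofReal_integral_eq_lintegral_ofReal]
  rotate_left
  · exact hcont.integrableOn_Icc.mono_set Ioo_subset_Icc_self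
  · refine (ae_restrict_iff' measurableSet_Ioo).2 (.of_forall fun s hs ↦ ?_)
    have := hc0 s (Ioo_subset_Icc_self hs)
    have := hr.trans hs.1
    simp only [Pi.zero_apply]
    positivity
  refine le_trans ?_ (lintegral_mono_set (s := Ioo r ρ) fun s hs ↦ hr.trans hs.1)
  refine setLIntegral_mono' measurableSet_Ioo fun s hs ↦ ?_
  have hs0 : 0 < s := hr.trans hs.1
  have hin : ∀ θ : ℝ, {z : ℂ | r < ‖z‖ ∧ ‖z‖ < ρ}.indicator (fun z ↦ ENNReal.ofReal (φ z))
      (Complex.polarCoord.symm (s, θ)) = ENNReal.ofReal (φ (circleMap 0 s θ)) := fun θ ↦ by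
    rw [hsymm, indicator_of_mem]
    simpa [abs_of_pos hs0] using hs
  have hper : Function.Periodic (fun θ ↦ φ (circleMap 0 s θ)) (2 * Real.pi) := fun θ ↦ by
    simp only [periodic_circleMap 0 s θ]
  have hint : IntervalIntegrable (fun θ ↦ φ (circleMap 0 s θ)) volume (-Real.pi) Real.pi :=
    hper.intervalIntegrable₀ Real.two_pi_pos.ne' (hi s hs) _ _
  have heq : ∫ θ in (-Real.pi)..Real.pi, φ (circleMap 0 s θ)
      = 2 * Real.pi * Real.circleAverage φ 0 s := by
    rw [Real.circleAverage_def, smul_eq_mul, mul_inv_cancel_left₀ Real.two_pi_pos.ne']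
    have := hper.intervalIntegral_add_eq (-Real.pi) 0
    rwa [zero_add, show -Real.pi + 2 * Real.pi = Real.pi by ring] at this
  simp only [hin, smul_eq_mul]
  rw [lintegral_const_mul _ (by
    exact (hφ.comp (continuous_circleMap 0 s).measurable).ennreal_ofReal),
    ← ofReal_integral_eq_lintegral_ofReal, ← ENNReal.ofReal_mul hs0.le,
    ← integral_Ioc_eq_integral_Ioo, ← intervalIntegral.integral_of_le (by linarith [Real.pi_pos]),
    heq]
  · apply ENNReal.ofReal_le_ofReal
    have := mul_le_mul_of_nonneg_left (hle s hs) (mul_pos hs0 Real.two_pi_pos).le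
    linarith
  · exact ((intervalIntegrable_iff_integrableOn_Ioc_of_le (by linarith [Real.pi_pos])).1
      hint).mono_set Ioo_subset_Ioc_self
  · exact .of_forall fun θ ↦ h0 _

/-- The real-linear map `w ↦ a * w + b * conj w` has determinant `‖a‖ ^ 2 - ‖b‖ ^ 2`. -/
theorem det_mul_add_mul_conj (a b : ℂ) (L : ℂ →ₗ[ℝ] ℂ) (hL : ∀ w, L w = a * w + b * conj w) :
    LinearMap.det L = ‖a‖ ^ 2 - ‖b‖ ^ 2 := by
  rw [← LinearMap.det_toMatrix Complex.basisOneI, Matrix.det_fin_two,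
    ← Complex.normSq_eq_norm_sq, ← Complex.normSq_eq_norm_sq]
  simp [LinearMap.toMatrix_apply, hL, Complex.normSq_apply]
  ring

/-- The exterior of an ellipse is connected. -/
theorem isPreconnected_setOf_lt_norm_sub_mul_conj {c : ℂ} (hc : ‖c‖ < 1) (M : ℝ) :
    IsPreconnected {w : ℂ | M < ‖w - c * conj w‖} := by
  set S : ℝ × ℝ → ℂ := fun p ↦
    (circleMap 0 p.1 p.2 + c * conj (circleMap 0 p.1 p.2)) / (1 - ‖c‖ ^ 2 : ℝ) with hS
  have hc2 : ((1 - ‖c‖ ^ 2 : ℝ) : ℂ) ≠ 0 := by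
    have := norm_nonneg c
    exact_mod_cast (by nlinarith : 0 < 1 - ‖c‖ ^ 2).ne'
  have hcc : c * conj c = ((‖c‖ ^ 2 : ℝ) : ℂ) := by
    rw [Complex.mul_conj, Complex.normSq_eq_norm_sq]
  have hcont : Continuous S := by
    have : Continuous fun p : ℝ × ℝ ↦ circleMap 0 p.1 p.2 := Real.circleMap.continuous
    have h2 := Complex.continuous_conj.comp this
    simp only [hS, div_eq_mul_inv]
    exact (this.add (continuous_const.mul h2)).mul continuous_const
  have : {w : ℂ | M < ‖w - c * conj w‖} = S '' (Ioi M ×ˢ univ) := by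
    ext w
    constructor
    · intro hw
      refine ⟨(‖w - c * conj w‖, arg (w - c * conj w)), ⟨hw, mem_univ _⟩, ?_⟩
      have : circleMap 0 ‖w - c * conj w‖ (arg (w - c * conj w)) = w - c * conj w := by
        rw [circleMap_zero, Complex.norm_mul_exp_arg_mul_I]
      simp only [hS, this, map_sub, map_mul, Complex.conj_conj]
      rw [div_eq_iff hc2]
      push_cast at hcc ⊢
      linear_combination (-w) * hcc
    · rintro ⟨⟨s, θ⟩, ⟨hs, -⟩, rfl⟩
      have hs : M < s := hs
      set v := circleMap 0 s θ with hv
      have : S (s, θ) - c * conj (S (s, θ)) = v := by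
        simp only [hS, ← hv, map_div₀, map_add, map_mul, Complex.conj_conj, Complex.conj_ofReal]
        field_simp
        push_cast at hcc ⊢
        linear_combination (-v) * hcc
      simp only [mem_ofPred_eq, this, hv, norm_circleMap_zero]
      exact hs.trans_le (le_abs_self s)
  rw [this]
  exact (isPreconnected_Ioi.prod isPreconnected_univ).image _ hcont.continuousOn

theorem volume_setOf_norm_sub_mul_conj_le {c : ℂ} (hc : ‖c‖ < 1) {M : ℝ} (hM : 0 ≤ M) :
    volume {w : ℂ | ‖w - c * conj w‖ ≤ M} =
      ENNReal.ofReal (Real.pi * M ^ 2 / (1 - ‖c‖ ^ 2)) := by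
  let L : ℂ →ₗ[ℝ] ℂ := LinearMap.id - (LinearMap.mulLeft ℝ c) ∘ₗ Complex.conjAe.toLinearMap
  have hL : ∀ w, L w = 1 * w + (-c) * conj w := fun w ↦ by simp [L]; ring
  have hdet := det_mul_add_mul_conj _ _ L hL
  rw [norm_one, norm_neg, one_pow] at hdet
  have hpos : 0 < 1 - ‖c‖ ^ 2 := by nlinarith [norm_nonneg c]
  have : {w : ℂ | ‖w - c * conj w‖ ≤ M} = L ⁻¹' closedBall 0 M := by
    ext w
    simp [hL, sub_eq_add_neg]
  rw [this, Measure.addHaar_preimage_linearMap _ (hdet ▸ hpos.ne'), hdet,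
    Complex.volume_closedBall, abs_of_pos (inv_pos.2 hpos), div_eq_mul_inv, mul_comm,
    ENNReal.ofReal_mul (by positivity), mul_comm Real.pi, ENNReal.ofReal_mul (by positivity),
    ENNReal.ofReal_pow hM]
  congr 2
  rw [← NNReal.coe_real_pi, ENNReal.ofReal_coe_nnreal]

theorem norm_sub_mul_conj_le_of_injOn {h : ℂ → ℂ} {H : ℂ → ℂ}
    (hH : DifferentiableOn ℂ H (ball 0 1)) (hh : ∀ z, h z = z⁻¹ + H z)
    (hinj : InjOn h (ball 0 1 \ {0})) {c : ℂ} (hc : ‖c‖ < 1) {r M : ℝ} (hr : 0 < r) (hr1 : r < 1)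
    (hbd : ∀ z, ‖z‖ = r → ‖h z - c * conj (h z)‖ ≤ M)
    {z : ℂ} (hrz : r < ‖z‖) (hz1 : ‖z‖ < 1) : ‖h z - c * conj (h z)‖ ≤ M := by
  by_contra! hz
  set V := h '' (ball 0 r \ {0}) with hV
  have hsub : closedBall (0 : ℂ) r ⊆ ball 0 1 := closedBall_subset_ball hr1
  have hopen : IsOpen (ball (0 : ℂ) r \ {0}) := isOpen_ball.sdiff isClosed_singleton
  have hVo : IsOpen V := by
    rw [isOpen_iff_mem_nhds]
    rintro _ ⟨x, hx, rfl⟩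
    have hx1 : x ∈ ball (0 : ℂ) 1 := hsub (ball_subset_closedBall hx.1)
    have han : AnalyticAt ℂ h x := by
      have : h = fun z ↦ z⁻¹ + H z := funext hh
      rw [this]
      exact (analyticAt_inv hx.2).add (hH.analyticAt (isOpen_ball.mem_nhds hx1))
    rcases han.eventually_constant_or_nhds_le_map_nhds_aux with hcst | hle
    · exfalso
      have h1 : ∀ᶠ y in 𝓝[≠] x, h y = h x ∧ y ∈ ball (0 : ℂ) r \ {0} ∧ y ≠ x := by
        filter_upwards [hcst.filter_mono nhdsWithin_le_nhds,
          mem_nhdsWithin_of_mem_nhds (hopen.mem_nhds hx), self_mem_nhdsWithin] with y a b c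
        exact ⟨a, b, c⟩
      obtain ⟨y, hy, hyr, hyx⟩ := h1.exists
      exact hyx (hinj ⟨hsub (ball_subset_closedBall hyr.1), hyr.2⟩ ⟨hx1, hx.2⟩ hy)
    · exact hle (image_mem_map (hopen.mem_nhds hx))
  have hpre := isPreconnected_setOf_lt_norm_sub_mul_conj hc M
  have hne : ({w : ℂ | M < ‖w - c * conj w‖} ∩ V).Nonempty := by
    have ht : Tendsto (fun z : ℂ ↦ ‖z⁻¹‖ + -‖H z‖) (𝓝[≠] 0) atTop := by
      refine Tendsto.atTop_add (tendsto_norm_cobounded_atTop.comp tendsto_inv₀_nhdsNE_zero)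
        (C := -‖H 0‖) ?_
      exact ((hH.continuousOn.continuousAt (ball_mem_nhds 0 one_pos)).norm.neg).mono_left
        nhdsWithin_le_nhds
    have h1 : ∀ᶠ z in 𝓝[≠] (0 : ℂ), z ∈ ball (0 : ℂ) r :=
      mem_nhdsWithin_of_mem_nhds (ball_mem_nhds 0 hr)
    obtain ⟨z, hzM, hzr, hz0⟩ := ((ht.eventually_gt_atTop (M / (1 - ‖c‖))).and
      (h1.and self_mem_nhdsWithin)).exists
    refine ⟨h z, ?_, z, ⟨hzr, hz0⟩, rfl⟩
    have h2 : ‖z⁻¹‖ - ‖H z‖ ≤ ‖h z‖ := by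
      rw [hh]; simpa using norm_sub_norm_le z⁻¹ (-H z)
    have h3 : ‖h z‖ - ‖c‖ * ‖h z‖ ≤ ‖h z - c * conj (h z)‖ := by
      simpa using norm_sub_norm_le (h z) (c * conj (h z))
    rw [div_lt_iff₀ (by linarith)] at hzM
    have h4 := mul_le_mul_of_nonneg_right h2 (by linarith : 0 ≤ 1 - ‖c‖)
    simp only [mem_ofPred_eq]
    linarith
  have hcl : closure V ∩ {w : ℂ | M < ‖w - c * conj w‖} ⊆ V := by
    rintro w ⟨hw, hwM⟩
    obtain ⟨u, huV, huw⟩ := mem_closure_iff_seq_limit.1 hw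
    choose x hx hxu using huV
    obtain ⟨y, hy, φ, hφ, hlim⟩ := (isCompact_closedBall (0 : ℂ) r).tendsto_subseq
      fun n ↦ ball_subset_closedBall (hx n).1
    have hHc : Tendsto (fun n ↦ H (x (φ n))) atTop (𝓝 (H y)) :=
      (hH.continuousOn.continuousAt (isOpen_ball.mem_nhds (hsub hy))).tendsto.comp hlim
    have h1 : Tendsto (fun n ↦ u (φ n) * x (φ n)) atTop (𝓝 (w * y)) :=
      (huw.comp hφ.tendsto_atTop).mul hlim
    have h2 : Tendsto (fun n ↦ 1 + x (φ n) * H (x (φ n))) atTop (𝓝 (1 + y * H y)) :=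
      (hlim.mul hHc).const_add 1
    have h3 : w * y = 1 + y * H y := by
      refine tendsto_nhds_unique h1 (h2.congr fun n ↦ ?_)
      have : x (φ n) ≠ 0 := (hx (φ n)).2
      rw [← hxu, hh]
      field_simp
    have hy0 : y ≠ 0 := by rintro rfl; simp at h3
    have hwy : h y = w := by
      rw [hh]; field_simp; linear_combination -h3
    refine ⟨y, ⟨?_, hy0⟩, hwy⟩
    rw [mem_ball_zero_iff]
    refine lt_of_le_of_ne (mem_closedBall_zero_iff.1 hy) fun hyr ↦ ?_
    exact absurd (hbd y hyr) (by rw [hwy]; exact not_le.2 hwM)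
  obtain ⟨x, hx, hxz⟩ := hpre.subset_of_closure_inter_subset hVo hne hcl hz
  have hxr : ‖x‖ < r := mem_ball_zero_iff.1 hx.1
  have : x = z := hinj ⟨hsub (ball_subset_closedBall hx.1), hx.2⟩
    ⟨mem_ball_zero_iff.2 hz1, norm_pos_iff.1 (hr.trans hrz)⟩ hxz
  rw [this] at hxr
  exact lt_asymm hxr hrz

theorem ofReal_le_volume_image_annulus {h : ℂ → ℂ} {H : ℂ → ℂ}
    (hH : DifferentiableOn ℂ H (ball 0 1)) (hh : ∀ z, h z = z⁻¹ + H z)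
    (hinj : InjOn h (ball 0 1 \ {0})) {r ρ : ℝ} (hr : 0 < r) (hrρ : r ≤ ρ) (hρ : ρ < 1) :
    ENNReal.ofReal (Real.pi * ((r ^ 2)⁻¹ - (ρ ^ 2)⁻¹ + ‖deriv H 0‖ ^ 2 * (ρ ^ 2 - r ^ 2))) ≤
      volume (h '' {z : ℂ | r < ‖z‖ ∧ ‖z‖ < ρ}) := by
  have hA : MeasurableSet {z : ℂ | r < ‖z‖ ∧ ‖z‖ < ρ} :=
    (measurableSet_lt measurable_const measurable_norm).inter
      (measurableSet_lt measurable_norm measurable_const)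
  have hk : DifferentiableOn ℂ (deriv H) (ball 0 1) := hH.deriv isOpen_ball
  have hAsub : {z : ℂ | r < ‖z‖ ∧ ‖z‖ < ρ} ⊆ ball 0 1 \ {0} := fun z hz ↦
    ⟨mem_ball_zero_iff.2 (hz.2.trans hρ), norm_pos_iff.1 (hr.trans hz.1)⟩
  have hder : ∀ z ∈ ball (0 : ℂ) 1 \ {0}, HasDerivAt h (deriv H z - (z ^ 2)⁻¹) z := fun z hz ↦ by
    have : h = fun z ↦ z⁻¹ + H z := funext hh
    rw [this]
    refine ((hasDerivAt_inv hz.2).add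
      (hH.differentiableAt (isOpen_ball.mem_nhds hz.1)).hasDerivAt).congr_deriv ?_
    ring
  have hdet : ∀ a : ℂ, ((ContinuousLinearMap.toSpanSingleton ℂ a).restrictScalars ℝ).det
      = ‖a‖ ^ 2 := fun a ↦ by
    rw [ContinuousLinearMap.det, det_mul_add_mul_conj a 0]
    · simp
    · intro w; simp [mul_comm]
  rw [← lintegral_abs_det_fderiv_eq_addHaar_image volume hA
    (fun z hz ↦ ((hder z (hAsub hz)).hasFDerivAt.restrictScalars ℝ).hasFDerivWithinAt)
    (hinj.mono hAsub)]
  simp only [hdet]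
  set φ : ℂ → ℝ := fun z ↦ ‖deriv h z‖ ^ 2 with hφ
  have hcongr : ∀ z ∈ {z : ℂ | r < ‖z‖ ∧ ‖z‖ < ρ},
      ENNReal.ofReal |‖deriv H z - (z ^ 2)⁻¹‖ ^ 2| = ENNReal.ofReal (φ z) := fun z hz ↦ by
    simp only [hφ, (hder z (hAsub hz)).deriv, abs_pow, abs_norm]
  rw [setLIntegral_congr_fun hA hcongr]
  have hsph : ∀ s ∈ Ioo r ρ, sphere (0 : ℂ) |s| ⊆ ball 0 1 \ {0} := fun s hs z hz ↦ by
    have hs0 := hr.trans hs.1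
    have hzs : ‖z‖ = s := by simpa [abs_of_pos hs0] using hz
    exact ⟨mem_ball_zero_iff.2 (hzs ▸ hs.2.trans hρ), norm_pos_iff.1 (hzs ▸ hs0)⟩
  have hφs : ∀ s ∈ Ioo r ρ, EqOn φ (fun z ↦ ‖deriv H z - (z ^ 2)⁻¹‖ ^ 2) (sphere 0 |s|) :=
    fun s hs z hz ↦ by simp only [hφ, (hder z (hsph s hs hz)).deriv]
  have key := ofReal_integral_le_lintegral_annulus (φ := φ)
    (c := fun s ↦ (s ^ 4)⁻¹ + ‖deriv H 0‖ ^ 2) ((measurable_deriv h).norm.pow_const 2)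
    (fun z ↦ by positivity) hr hrρ
    (ContinuousOn.add (ContinuousOn.inv₀ (by fun_prop)
      fun s hs ↦ pow_ne_zero 4 (hr.trans_le hs.1).ne') continuousOn_const)
    (fun s hs ↦ by positivity)
    (fun s hs ↦ by
      apply ContinuousOn.circleIntegrable'
      refine ContinuousOn.congr ?_ (hφs s hs)
      have h1 := hk.continuousOn.mono ((hsph s hs).trans sdiff_subset)
      have h2 : ContinuousOn (fun z : ℂ ↦ (z ^ 2)⁻¹) (sphere 0 |s|) :=
        ContinuousOn.inv₀ (by fun_prop) fun z hz ↦ pow_ne_zero 2 (hsph s hs hz).2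
      fun_prop)
    (fun s hs ↦ by
      rw [Real.circleAverage_congr_sphere (hφs s hs)]
      exact le_circleAverage_normSq_sub_inv_sq hk (hr.trans hs.1) (hs.2.trans hρ))
  refine le_of_eq_of_le ?_ key
  congr 1
  have hne : ∀ s ∈ uIcc r ρ, s ≠ 0 := fun s hs ↦ by
    rw [uIcc_of_le hrρ] at hs
    exact (hr.trans_le hs.1).ne'
  have hftc := intervalIntegral.integral_eq_sub_of_hasDerivAt (a := r) (b := ρ)
    (f := fun s : ℝ ↦ Real.pi * (‖deriv H 0‖ ^ 2 * s ^ 2 - (s ^ 2)⁻¹))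
    (f' := fun s ↦ 2 * Real.pi * (s * ((s ^ 4)⁻¹ + ‖deriv H 0‖ ^ 2)))
    (fun s hs ↦ by
      have hs0 := hne s hs
      refine (((hasDerivAt_pow 2 s).const_mul _).sub
        ((hasDerivAt_pow 2 s).inv (pow_ne_zero 2 hs0))).const_mul Real.pi |>.congr_deriv ?_
      field_simp
      ring)
    (by
      apply ContinuousOn.intervalIntegrable
      have : ContinuousOn (fun s : ℝ ↦ (s ^ 4)⁻¹) (uIcc r ρ) :=
        ContinuousOn.inv₀ (by fun_prop) fun s hs ↦ pow_ne_zero 4 (hne s hs)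
      fun_prop)
  rw [hftc]
  ring

/-- A case of **Gronwall's area theorem**. -/
theorem norm_deriv_le_one_of_injOn_inv_add {h : ℂ → ℂ} {H : ℂ → ℂ}
    (hH : DifferentiableOn ℂ H (ball 0 1)) (hH0 : H 0 = 0) (hh : ∀ z, h z = z⁻¹ + H z)
    (hinj : InjOn h (ball 0 1 \ {0})) : ‖deriv H 0‖ ≤ 1 := by
  set b := deriv H 0 with hb
  have hball : ball (0 : ℂ) 1 ∈ 𝓝 0 := ball_mem_nhds 0 one_pos
  have hD : DifferentiableAt ℂ (dslope H 0) 0 :=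
    (((differentiableOn_dslope hball).2 hH).differentiableAt hball)
  obtain ⟨K, hK, hbound⟩ := hD.isBigO_sub.exists_nonneg
  obtain ⟨ε, hε, hεK⟩ := Metric.eventually_nhds_iff_ball.1 hbound.bound
  simp only [dslope_same, ← hb, sub_zero] at hεK
  have hHD : ∀ z, H z = z * dslope H 0 z := fun z ↦ by
    simpa [hH0] using (sub_smul_dslope H 0 z).symm
  set L := K + ‖b‖ * (‖b‖ + K) with hL
  have hL0 : 0 ≤ L := by positivity
  have hcirc : ∀ r, 0 < r → r < 1 → r < ε → ∀ z, ‖z‖ = r →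
      ‖h z - b * r ^ 2 * conj (h z)‖ ≤ r⁻¹ + L * r ^ 2 := by
    intro r hr hr1 hrε z hz
    have hz0 : z ≠ 0 := norm_pos_iff.1 (hz ▸ hr)
    have hDz := hεK z (by simpa [hz] using hrε)
    rw [hz] at hDz
    have hDn : ‖dslope H 0 z‖ ≤ ‖b‖ + K * r := by
      have := norm_le_norm_add_norm_sub' (dslope H 0 z) b
      linarith
    have hconj : (r : ℂ) ^ 2 * conj (z⁻¹) = z := by
      rw [map_inv₀, ← hz]
      have := Complex.conj_mul' z
      have h0 : conj z ≠ 0 := by simpa using hz0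
      field_simp
      exact this.symm
    have heq : h z - b * r ^ 2 * conj (h z)
        = z⁻¹ + z * (dslope H 0 z - b) - b * r ^ 2 * conj (z * dslope H 0 z) := by
      rw [hh, map_add, hHD z]
      linear_combination (-b) * hconj
    rw [heq]
    have e1 : ‖z⁻¹‖ = r⁻¹ := by rw [norm_inv, hz]
    have e2 : ‖z * (dslope H 0 z - b)‖ ≤ r * (K * r) := by
      rw [norm_mul, hz]; gcongr
    have e3 : ‖b * r ^ 2 * conj (z * dslope H 0 z)‖ ≤ ‖b‖ * r ^ 2 * (1 * (‖b‖ + K * 1)) := by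
      rw [norm_mul, norm_mul, norm_pow, RCLike.norm_conj, norm_mul, hz, Complex.norm_real,
        Real.norm_of_nonneg hr.le]
      have : ‖dslope H 0 z‖ ≤ ‖b‖ + K * 1 := hDn.trans (by gcongr)
      gcongr
    calc _ ≤ ‖z⁻¹‖ + ‖z * (dslope H 0 z - b)‖ + ‖b * r ^ 2 * conj (z * dslope H 0 z)‖ :=
          (norm_sub_le _ _).trans (by gcongr; exact norm_add_le _ _)
      _ ≤ r⁻¹ + r * (K * r) + ‖b‖ * r ^ 2 * (1 * (‖b‖ + K * 1)) := by rw [e1]; gcongr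
      _ = _ := by rw [hL]; ring
  have hineq : ∀ ρ, 0 < ρ → ρ < 1 → ‖b‖ ^ 2 * ρ ^ 2 - (ρ ^ 2)⁻¹ ≤ 0 := by
    intro ρ hρ hρ1
    have hev : ∀ᶠ r in 𝓝[>] (0 : ℝ),
        (‖b‖ ^ 2 * (ρ ^ 2 - r ^ 2) - (ρ ^ 2)⁻¹) * (1 - ‖b‖ ^ 2 * r ^ 4) ≤
          ‖b‖ ^ 2 * r ^ 2 + 2 * L * r + L ^ 2 * r ^ 4 := by
      have hsmall : ∀ᶠ r in 𝓝 (0 : ℝ), ‖b‖ * r ^ 2 < 1 := by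
        refine ContinuousAt.eventually_lt (by fun_prop) continuousAt_const ?_
        simp
      filter_upwards [self_mem_nhdsWithin, mem_nhdsWithin_of_mem_nhds (Iio_mem_nhds hρ),
        mem_nhdsWithin_of_mem_nhds (Iio_mem_nhds hε), nhdsWithin_le_nhds hsmall]
        with r hr hrρ hrε hbr
      have hr : 0 < r := hr
      have hrρ : r < ρ := hrρ
      have hc : ‖b * (r : ℂ) ^ 2‖ = ‖b‖ * r ^ 2 := by
        rw [norm_mul, norm_pow, Complex.norm_real, Real.norm_of_nonneg hr.le]
      have hc1 : ‖b * (r : ℂ) ^ 2‖ < 1 := hc ▸ hbr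
      have hM : 0 ≤ r⁻¹ + L * r ^ 2 := by positivity
      have hsub : h '' {z : ℂ | r < ‖z‖ ∧ ‖z‖ < ρ} ⊆
          {w | ‖w - b * r ^ 2 * conj w‖ ≤ r⁻¹ + L * r ^ 2} := by
        rintro _ ⟨z, hz, rfl⟩
        exact norm_sub_mul_conj_le_of_injOn hH hh hinj hc1 hr (hrρ.trans hρ1)
          (hcirc r hr (hrρ.trans hρ1) hrε) hz.1 (hz.2.trans hρ1)
      have hvol := (ofReal_le_volume_image_annulus hH hh hinj hr hrρ.le hρ1).trans
        (measure_mono hsub)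
      rw [volume_setOf_norm_sub_mul_conj_le hc1 hM, hc] at hvol
      have hpos : 0 < 1 - (‖b‖ * r ^ 2) ^ 2 := by
        nlinarith [show 0 ≤ ‖b‖ * r ^ 2 by positivity]
      rw [ENNReal.ofReal_le_ofReal_iff (by have := Real.pi_pos; positivity),
        mul_div_assoc, mul_le_mul_iff_right₀ Real.pi_pos, le_div_iff₀ hpos] at hvol
      have e1 : (r ^ 2)⁻¹ * (1 - (‖b‖ * r ^ 2) ^ 2) = (r ^ 2)⁻¹ - ‖b‖ ^ 2 * r ^ 2 := by
        field_simp
      have e2 : (r⁻¹ + L * r ^ 2) ^ 2 = (r ^ 2)⁻¹ + 2 * L * r + L ^ 2 * r ^ 4 := by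
        field_simp; ring
      rw [e2] at hvol
      linear_combination hvol - e1
    have hl : Tendsto (fun r : ℝ ↦
        (‖b‖ ^ 2 * (ρ ^ 2 - r ^ 2) - (ρ ^ 2)⁻¹) * (1 - ‖b‖ ^ 2 * r ^ 4)) (𝓝[>] 0)
        (𝓝 ((‖b‖ ^ 2 * (ρ ^ 2 - 0 ^ 2) - (ρ ^ 2)⁻¹) * (1 - ‖b‖ ^ 2 * 0 ^ 4))) :=
      (Continuous.tendsto (by fun_prop) 0).mono_left nhdsWithin_le_nhds
    have hr : Tendsto (fun r : ℝ ↦ ‖b‖ ^ 2 * r ^ 2 + 2 * L * r + L ^ 2 * r ^ 4) (𝓝[>] 0)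
        (𝓝 (‖b‖ ^ 2 * 0 ^ 2 + 2 * L * 0 + L ^ 2 * 0 ^ 4)) :=
      (Continuous.tendsto (by fun_prop) 0).mono_left nhdsWithin_le_nhds
    have := le_of_tendsto_of_tendsto hl hr hev
    norm_num at this
    linarith
  have hlim : Tendsto (fun ρ : ℝ ↦ ‖b‖ ^ 2 * ρ ^ 2 - (ρ ^ 2)⁻¹) (𝓝[<] 1)
      (𝓝 (‖b‖ ^ 2 * 1 ^ 2 - (1 ^ 2)⁻¹)) := by
    refine ContinuousAt.tendsto (f := fun ρ : ℝ ↦ ‖b‖ ^ 2 * ρ ^ 2 - (ρ ^ 2)⁻¹) (x := 1) ?_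
      |>.mono_left nhdsWithin_le_nhds
    exact ContinuousAt.sub (by fun_prop) (ContinuousAt.inv₀ (by fun_prop) (by norm_num))
  have := le_of_tendsto hlim (by
    filter_upwards [self_mem_nhdsWithin, mem_nhdsWithin_of_mem_nhds (Ioi_mem_nhds one_pos)]
      with ρ h1 h0 using hineq ρ h0 h1)
  norm_num at this
  exact this

theorem exists_exp_sq_mul_eq {p : ℂ → ℂ} (hp : DifferentiableOn ℂ p (ball 0 1))
    (hp0 : ∀ z ∈ ball (0 : ℂ) 1, p z ≠ 0) :
    ∃ s : ℂ → ℂ, DifferentiableOn ℂ s (ball 0 1) ∧ s 0 = 1 ∧ (∀ z, s z ≠ 0) ∧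
      ∀ z ∈ ball (0 : ℂ) 1, s z ^ 2 * p z = p 0 := by
  have h0 : (0 : ℂ) ∈ ball (0 : ℂ) 1 := mem_ball_self one_pos
  obtain ⟨F, hF⟩ := ((hp.deriv isOpen_ball).div hp hp0).isExactOn_ball
  set s : ℂ → ℂ := fun z ↦ exp (-(F z - F 0) / 2) with hs
  have hsd : ∀ z ∈ ball (0 : ℂ) 1, HasDerivAt s (s z * (-(deriv p z / p z) / 2)) z :=
    fun z hz ↦ (((hF z hz).sub_const (F 0)).neg.div_const 2).cexp
  have hder : ∀ z ∈ ball (0 : ℂ) 1, HasDerivAt (fun z ↦ s z ^ 2 * p z) 0 z := fun z hz ↦ by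
    refine (((hsd z hz).pow 2).mul
      (hp.differentiableAt (isOpen_ball.mem_nhds hz)).hasDerivAt).congr_deriv ?_
    have := hp0 z hz
    simp only [Pi.pow_apply]
    field_simp
    ring
  have hs0 : s 0 = 1 := by simp [hs]
  refine ⟨s, fun z hz ↦ (hsd z hz).differentiableAt.differentiableWithinAt, hs0,
    fun z ↦ exp_ne_zero _, fun z hz ↦ ?_⟩
  have := isOpen_ball.is_const_of_deriv_eq_zero (convex_ball (0 : ℂ) 1).isPreconnected
    (fun z hz ↦ (hder z hz).differentiableAt.differentiableWithinAt)
    (fun z hz ↦ (hder z hz).deriv) hz h0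
  simpa [hs0] using this

/-- **Bieberbach's inequality** for the second coefficient of an injective holomorphic function. -/
theorem norm_deriv_deriv_zero_le_of_injOn {f : ℂ → ℂ} (hf : DifferentiableOn ℂ f (ball 0 1))
    (hinj : InjOn f (ball 0 1)) (ha : deriv f 0 ≠ 0) :
    ‖deriv (deriv f) 0‖ ≤ 4 * ‖deriv f 0‖ := by
  have h0 : (0 : ℂ) ∈ ball (0 : ℂ) 1 := mem_ball_self one_pos
  have hball : ball (0 : ℂ) 1 ∈ 𝓝 0 := ball_mem_nhds 0 one_pos
  set p := dslope f 0 with hp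
  have hpd : DifferentiableOn ℂ p (ball 0 1) := (differentiableOn_dslope hball).2 hf
  have hp0 : p 0 = deriv f 0 := dslope_same f 0
  have hfp : ∀ z, z * p z = f z - f 0 := fun z ↦ by simpa using sub_smul_dslope f 0 z
  have hpne : ∀ z ∈ ball (0 : ℂ) 1, p z ≠ 0 := fun z hz hpz ↦ by
    rcases eq_or_ne z 0 with rfl | hz0
    · exact ha (hp0 ▸ hpz)
    · have := hfp z
      rw [hpz, mul_zero, eq_comm, sub_eq_zero] at this
      exact hz0 (hinj hz h0 this)
  have hf2 : deriv (deriv f) 0 = 2 * deriv p 0 := by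
    have h1 : deriv f =ᶠ[𝓝 0] fun z ↦ p z + z * deriv p z := by
      filter_upwards [isOpen_ball.mem_nhds h0] with z hz
      have h2 : f = fun z ↦ z * p z + f 0 := funext fun z ↦ by rw [hfp]; ring
      have h3 := ((hasDerivAt_id z).mul
        (hpd.differentiableAt (isOpen_ball.mem_nhds hz)).hasDerivAt).add_const (f 0)
      rw [h2]
      simpa using h3.deriv
    rw [h1.deriv_eq]
    have h4 := (hpd.differentiableAt hball).hasDerivAt.add ((hasDerivAt_id (0 : ℂ)).mul
      ((hpd.deriv isOpen_ball).differentiableAt hball).hasDerivAt)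
    have := h4.deriv
    simp only [id, one_mul, zero_mul, add_zero] at this
    rw [two_mul, ← this]
    rfl
  obtain ⟨s, hs, hs0, hsne, hsp⟩ := exists_exp_sq_mul_eq hpd hpne
  have hs' : deriv f 0 * (2 * deriv s 0) = -deriv p 0 := by
    have h1 := ((hs.differentiableAt hball).hasDerivAt.pow 2).mul
      (hpd.differentiableAt hball).hasDerivAt
    have h2 : (s ^ 2 * p) =ᶠ[𝓝 0] fun _ ↦ p 0 := by
      filter_upwards [hball] with z hz using hsp z hz
    have h3 := h2.deriv_eq
    rw [h1.deriv, deriv_const] at h3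
    simp only [Pi.pow_apply, hs0, hp0] at h3
    linear_combination h3
  set H : ℂ → ℂ := fun z ↦ z * dslope s 0 (z ^ 2) with hH
  have hsq : MapsTo (fun z : ℂ ↦ z ^ 2) (ball 0 1) (ball 0 1) := fun z hz ↦ by
    rw [mem_ball_zero_iff] at hz ⊢
    rw [norm_pow]
    exact pow_lt_one₀ (norm_nonneg z) hz two_ne_zero
  have hSd : DifferentiableOn ℂ (fun z ↦ dslope s 0 (z ^ 2)) (ball 0 1) :=
    ((differentiableOn_dslope hball).2 hs).comp (by fun_prop) hsq
  have hHd : DifferentiableOn ℂ H (ball 0 1) := differentiableOn_id.mul hSd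
  have hH' : deriv H 0 = deriv s 0 := by
    have := ((hasDerivAt_id (0 : ℂ)).mul (hSd.differentiableAt hball).hasDerivAt).deriv
    simp only [id, one_mul, zero_mul, add_zero, ne_eq, OfNat.ofNat_ne_zero, not_false_eq_true,
      zero_pow, dslope_same] at this
    exact this
  have hhs : ∀ z ≠ 0, z⁻¹ + H z = z⁻¹ * s (z ^ 2) := fun z hz ↦ by
    have := sub_smul_dslope s 0 (z ^ 2)
    simp only [sub_zero, smul_eq_mul, hs0] at this
    simp only [hH]
    field_simp
    linear_combination this
  have hhinj : InjOn (fun z ↦ z⁻¹ + H z) (ball 0 1 \ {0}) := by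
    rintro z ⟨hz, hz0⟩ w ⟨hw, hw0⟩ hzw
    have hz0 : z ≠ 0 := hz0
    have hw0 : w ≠ 0 := hw0
    simp only [hhs z hz0, hhs w hw0] at hzw
    have hz2 := hsp _ (hsq hz)
    have hw2 := hsp _ (hsq hw)
    have hsw : s (z ^ 2) * w = s (w ^ 2) * z := by
      field_simp at hzw
      linear_combination hzw
    have hfe : f (z ^ 2) = f (w ^ 2) := by
      have e1 := hfp (z ^ 2)
      have e2 := hfp (w ^ 2)
      have e3 : s (w ^ 2) ^ 2 * (z ^ 2 * p (z ^ 2)) = s (w ^ 2) ^ 2 * (w ^ 2 * p (w ^ 2)) := by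
        linear_combination w ^ 2 * hz2 - w ^ 2 * hw2
          - p (z ^ 2) * (s (z ^ 2) * w + s (w ^ 2) * z) * hsw
      have e4 := mul_left_cancel₀ (pow_ne_zero 2 (hsne _)) e3
      linear_combination e4 - e1 + e2
    have hzw2 : z ^ 2 = w ^ 2 := hinj (hsq hz) (hsq hw) hfe
    rw [hzw2] at hsw
    exact (mul_left_cancel₀ (hsne _) hsw).symm
  have hb := norm_deriv_le_one_of_injOn_inv_add hHd (by simp [hH]) (fun z ↦ rfl) hhinj
  rw [hH'] at hb
  have hn : ‖deriv p 0‖ = ‖deriv f 0‖ * (2 * ‖deriv s 0‖) := by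
    rw [← norm_neg, ← hs', norm_mul, norm_mul, Complex.norm_two]
  rw [hf2, norm_mul, Complex.norm_two, hn]
  nlinarith [mul_le_mul_of_nonneg_left hb (norm_nonneg (deriv f 0))]

theorem norm_deriv_deriv_mul_sub_le_of_injOn {f : ℂ → ℂ} (hf : DifferentiableOn ℂ f (ball 0 1))
    (hinj : InjOn f (ball 0 1)) {ζ : ℂ} (hζ : ‖ζ‖ < 1) (ha : deriv f ζ ≠ 0) :
    ‖deriv (deriv f) ζ * (1 - ‖ζ‖ ^ 2 : ℝ) - 2 * conj ζ * deriv f ζ‖ ≤ 4 * ‖deriv f ζ‖ := by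
  have h0 : (0 : ℂ) ∈ ball (0 : ℂ) 1 := mem_ball_self one_pos
  have hζb : ζ ∈ ball (0 : ℂ) 1 := mem_ball_zero_iff.2 hζ
  set q : ℝ := 1 - ‖ζ‖ ^ 2 with hq
  have hqpos : 0 < q := by nlinarith [norm_nonneg ζ]
  have hqc : (q : ℂ) = 1 - ζ * conj ζ := by
    rw [hq, Complex.mul_conj']; push_cast; rfl
  set m : ℂ → ℂ := fun z ↦ (z + ζ) / (1 + conj ζ * z) with hm
  have hden : ∀ z ∈ ball (0 : ℂ) 1, 1 + conj ζ * z ≠ 0 := fun z hz h ↦ by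
    have hz := mem_ball_zero_iff.1 hz
    have h1 : ‖conj ζ * z‖ = 1 := by
      rw [show conj ζ * z = -1 by linear_combination h]; simp
    rw [norm_mul, RCLike.norm_conj] at h1
    nlinarith [norm_nonneg ζ, norm_nonneg z]
  have hmd : ∀ z ∈ ball (0 : ℂ) 1, HasDerivAt m (q / (1 + conj ζ * z) ^ 2) z := fun z hz ↦ by
    refine (((hasDerivAt_id z).add_const ζ).div
      (((hasDerivAt_id z).const_mul (conj ζ)).const_add 1) (hden z hz)).congr_deriv ?_
    simp only [id]
    rw [hqc]
    congr 1
    ring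
  have hmaps : MapsTo m (ball 0 1) (ball 0 1) := fun z hz ↦ by
    have hd := hden z hz
    have hz := mem_ball_zero_iff.1 hz
    rw [mem_ball_zero_iff, norm_div, div_lt_one (norm_pos_iff.2 hd)]
    refine lt_of_pow_lt_pow_left₀ 2 (norm_nonneg _) ?_
    have e : ‖1 + conj ζ * z‖ ^ 2 - ‖z + ζ‖ ^ 2 = (1 - ‖z‖ ^ 2) * q := by
      rw [hq]
      simp only [← Complex.normSq_eq_norm_sq, Complex.normSq_apply]
      simp
      ring
    have : 0 < (1 - ‖z‖ ^ 2) * q := mul_pos (by nlinarith [norm_nonneg z]) hqpos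
    linarith
  have hminj : InjOn m (ball 0 1) := fun z hz w hw hzw ↦ by
    simp only [hm] at hzw
    rw [div_eq_div_iff (hden z hz) (hden w hw)] at hzw
    have : (q : ℂ) * (z - w) = 0 := by rw [hqc]; linear_combination hzw
    exact sub_eq_zero.1 ((mul_eq_zero.1 this).resolve_left (by exact_mod_cast hqpos.ne'))
  have hm0 : m 0 = ζ := by simp [hm]
  have hG' : ∀ z ∈ ball (0 : ℂ) 1,
      HasDerivAt (f ∘ m) (deriv f (m z) * (q / (1 + conj ζ * z) ^ 2)) z := fun z hz ↦
    (hf.differentiableAt (isOpen_ball.mem_nhds (hmaps hz))).hasDerivAt.comp z (hmd z hz)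
  have hG1 : deriv (f ∘ m) 0 = deriv f ζ * q := by
    rw [(hG' 0 h0).deriv, hm0]; simp
  have hG2 : deriv (deriv (f ∘ m)) 0
      = q * (deriv (deriv f) ζ * q - 2 * conj ζ * deriv f ζ) := by
    have h1 : deriv (f ∘ m) =ᶠ[𝓝 0] fun z ↦ deriv f (m z) * (q / (1 + conj ζ * z) ^ 2) := by
      filter_upwards [isOpen_ball.mem_nhds h0] with z hz using (hG' z hz).deriv
    rw [h1.deriv_eq]
    have hf2 : HasDerivAt (deriv f) (deriv (deriv f) ζ) (m 0) := by
      rw [hm0]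
      exact ((hf.deriv isOpen_ball).differentiableAt (isOpen_ball.mem_nhds hζb)).hasDerivAt
    have h2 := (hf2.comp 0 (hmd 0 h0)).mul ((hasDerivAt_const (0 : ℂ) (q : ℂ)).div
      ((((hasDerivAt_id (0 : ℂ)).const_mul (conj ζ)).const_add 1).pow 2) (by simp))
    refine h2.deriv.trans ?_
    simp [hm0]
    ring
  have key := norm_deriv_deriv_zero_le_of_injOn (f := f ∘ m)
    (fun z hz ↦ (hG' z hz).differentiableAt.differentiableWithinAt)
    (hinj.comp hminj hmaps) (by
      rw [hG1]; exact mul_ne_zero ha (by exact_mod_cast hqpos.ne'))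
  rw [hG1, hG2, norm_mul, norm_mul, Complex.norm_real, Real.norm_of_nonneg hqpos.le] at key
  refine le_of_mul_le_mul_left ?_ hqpos
  linarith

/-- **Koebe's distortion theorem**, upper bound for the derivative. -/
theorem norm_deriv_le_of_injOn {f : ℂ → ℂ} (hf : DifferentiableOn ℂ f (ball 0 1))
    (hinj : InjOn f (ball 0 1)) {e : ℂ} (he : ‖e‖ = 1) {t : ℝ} (ht0 : 0 ≤ t) (ht1 : t < 1) :
    ‖deriv f (t * e)‖ ≤ ‖deriv f 0‖ * ((1 + t) / (1 - t) ^ 3) := by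
  set u : ℝ → ℂ := fun x ↦ deriv f (x * e) with hu
  have hnorm : ∀ x : ℝ, 0 ≤ x → ‖(x : ℂ) * e‖ = x := fun x hx ↦ by
    rw [norm_mul, he, mul_one, Complex.norm_real, Real.norm_of_nonneg hx]
  have hud : ∀ x ∈ Icc 0 t, HasDerivAt u (deriv (deriv f) (x * e) * e) x := fun x hx ↦ by
    have hxb : (x : ℂ) * e ∈ ball (0 : ℂ) 1 :=
      mem_ball_zero_iff.2 ((hnorm x hx.1).trans_lt (hx.2.trans_lt ht1))
    have h1 := ((hf.deriv isOpen_ball).differentiableAt (isOpen_ball.mem_nhds hxb)).hasDerivAt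
    have h2 : HasDerivAt (fun x : ℝ ↦ (x : ℂ) * e) e x := by
      simpa using (Complex.ofRealCLM.hasDerivAt (x := x)).mul_const e
    exact h1.comp x h2
  have hin : ∀ x ∈ Icc 0 t,
      inner ℝ (u x) (deriv (deriv f) (x * e) * e) * (1 - x ^ 2) ≤ (4 + 2 * x) * ‖u x‖ ^ 2 := by
    intro x hx
    rcases eq_or_ne (u x) 0 with h0 | h0
    · simp [h0]
    have hxn := hnorm x hx.1
    have hk := norm_deriv_deriv_mul_sub_le_of_injOn hf hinj (ζ := x * e)
      (hxn.trans_lt (hx.2.trans_lt ht1)) h0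
    rw [hxn] at hk
    set v := deriv (deriv f) (x * e) with hv
    have hee : e * conj e = 1 := by rw [Complex.mul_conj', he]; simp
    have hk2 : ‖(1 - x ^ 2 : ℝ) • (v * e) - (2 * x) • u x‖ ≤ 4 * ‖u x‖ := by
      refine le_of_eq_of_le ?_ hk
      rw [← mul_one ‖v * _ - _‖, ← he, ← norm_mul]
      congr 1
      simp only [Complex.real_smul, map_mul, Complex.conj_ofReal]
      push_cast
      simp only [hu]
      linear_combination (2 * x * deriv f (x * e)) * hee
    have h1 : inner ℝ (u x) ((1 - x ^ 2 : ℝ) • (v * e) - (2 * x) • u x) ≤ ‖u x‖ * (4 * ‖u x‖) :=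
      (real_inner_le_norm _ _).trans (by gcongr)
    rw [inner_sub_right, real_inner_smul_right, real_inner_smul_right,
      real_inner_self_eq_norm_sq] at h1
    linarith
  have hN : ∀ x ∈ Icc 0 t, HasDerivAt (fun x ↦ ‖u x‖ ^ 2 * ((1 - x) ^ 6 / (1 + x) ^ 2))
      (2 * (inner ℝ (u x) (deriv (deriv f) (x * e) * e) * (1 - x ^ 2) - (4 + 2 * x) * ‖u x‖ ^ 2)
        * ((1 - x) ^ 5 / (1 + x) ^ 3)) x := by
    intro x hx
    have hx1 : 1 + x ≠ 0 := by linarith [hx.1]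
    refine ((hud x hx).norm_sq.mul ((((hasDerivAt_id x).const_sub 1).pow 6).div
      (((hasDerivAt_id x).const_add 1).pow 2) (pow_ne_zero 2 hx1))).congr_deriv ?_
    simp only [id, Pi.pow_apply, Pi.div_apply]
    field_simp
    ring
  have hanti : AntitoneOn (fun x ↦ ‖u x‖ ^ 2 * ((1 - x) ^ 6 / (1 + x) ^ 2)) (Icc 0 t) := by
    refine antitoneOn_of_deriv_nonpos (convex_Icc 0 t)
      (fun x hx ↦ (hN x hx).continuousAt.continuousWithinAt)
      (fun x hx ↦ (hN x (interior_subset hx)).differentiableAt.differentiableWithinAt)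
      fun x hx ↦ ?_
    have hx := interior_subset hx
    rw [(hN x hx).deriv]
    have h1 : 0 < 1 - x := by linarith [hx.2]
    have h2 : 0 < 1 + x := by linarith [hx.1]
    exact mul_nonpos_of_nonpos_of_nonneg (by linarith [hin x hx]) (by positivity)
  have h := hanti (left_mem_Icc.2 ht0) (right_mem_Icc.2 ht0) ht0
  have h1 : 0 < 1 - t := by linarith
  have h2 : 0 < 1 + t := by linarith
  simp only [hu, Complex.ofReal_zero, zero_mul, sub_zero, add_zero, one_pow, div_one,
    mul_one] at h
  refine le_of_sq_le_sq ?_ (by positivity)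
  rw [← mul_div_assoc, div_pow, le_div_iff₀ (by positivity)]
  rw [← mul_div_assoc, div_le_iff₀ (by positivity)] at h
  linarith

/-- **Koebe's growth theorem**, upper bound. -/
theorem norm_sub_le_of_injOn {f : ℂ → ℂ} (hf : DifferentiableOn ℂ f (ball 0 1))
    (hinj : InjOn f (ball 0 1)) {z : ℂ} (hz : ‖z‖ < 1) :
    ‖f z - f 0‖ ≤ ‖deriv f 0‖ * (‖z‖ / (1 - ‖z‖) ^ 2) := by
  rcases eq_or_ne z 0 with rfl | hz0
  · simp
  have hzn : 0 < ‖z‖ := norm_pos_iff.2 hz0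
  set e : ℂ := z / ‖z‖ with he
  have hen : ‖e‖ = 1 := by simp [he, hz0]
  have hze : (‖z‖ : ℂ) * e = z := by
    rw [he]; exact mul_div_cancel₀ z (by simpa using hz0)
  have hd : ∀ x ∈ Icc 0 ‖z‖, HasDerivAt (fun x : ℝ ↦ f (x * e) - f 0) (deriv f (x * e) * e) x := by
    intro x hx
    have hxb : (x : ℂ) * e ∈ ball (0 : ℂ) 1 := by
      rw [mem_ball_zero_iff, norm_mul, hen, mul_one, Complex.norm_real, Real.norm_of_nonneg hx.1]
      exact hx.2.trans_lt hz
    have h1 := (hf.differentiableAt (isOpen_ball.mem_nhds hxb)).hasDerivAt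
    have h2 : HasDerivAt (fun x : ℝ ↦ (x : ℂ) * e) e x := by
      simpa using (Complex.ofRealCLM.hasDerivAt (x := x)).mul_const e
    exact (h1.comp x h2).sub_const (f 0)
  have hB : ∀ x ∈ Icc 0 ‖z‖, HasDerivAt (fun x : ℝ ↦ ‖deriv f 0‖ * (x / (1 - x) ^ 2))
      (‖deriv f 0‖ * ((1 + x) / (1 - x) ^ 3)) x := by
    intro x hx
    have hx1 : 1 - x ≠ 0 := by linarith [hx.2]
    refine (((hasDerivAt_id x).div (((hasDerivAt_id x).const_sub 1).pow 2)
      (pow_ne_zero 2 hx1)).const_mul _).congr_deriv ?_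
    simp only [id, Pi.pow_apply]
    field_simp
    ring
  have := image_norm_le_of_norm_deriv_right_le_deriv_boundary'
    (fun x hx ↦ (hd x hx).continuousAt.continuousWithinAt)
    (fun x hx ↦ (hd x (Ico_subset_Icc_self hx)).hasDerivWithinAt)
    (by simp) (fun x hx ↦ (hB x hx).continuousAt.continuousWithinAt)
    (fun x hx ↦ (hB x (Ico_subset_Icc_self hx)).hasDerivWithinAt)
    (fun x hx ↦ by
      rw [norm_mul, hen, mul_one]
      exact norm_deriv_le_of_injOn hf hinj hen hx.1 (hx.2.trans hz))
    (right_mem_Icc.2 hzn.le)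
  rwa [hze] at this

theorem norm_le_four_mul_of_injOn {R : ℝ} (hR : 0 < R) {g : ℂ → ℂ}
    (hg : DifferentiableOn ℂ g (ball 0 (2 * R))) (hinj : InjOn g (ball 0 (2 * R)))
    (hg0 : g 0 = 0) {z : ℂ} (hz : ‖z‖ < R) : ‖g z‖ ≤ 4 * ‖deriv g 0‖ * ‖z‖ := by
  set T : ℂ := ((2 * R : ℝ) : ℂ) with hT
  have hTn : ‖T‖ = 2 * R := by rw [hT, Complex.norm_real, Real.norm_of_nonneg (by positivity)]
  have hT0 : T ≠ 0 := norm_pos_iff.1 (by rw [hTn]; positivity)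
  have hmaps : MapsTo (fun w ↦ T * w) (ball 0 1) (ball 0 (2 * R)) := fun w hw ↦ by
    rw [mem_ball_zero_iff] at hw ⊢
    rw [norm_mul, hTn]
    nlinarith
  have hw : ‖z / T‖ ≤ 1 / 2 := by
    rw [norm_div, hTn, div_le_iff₀ (by positivity)]
    linarith
  have key := norm_sub_le_of_injOn (f := fun w ↦ g (T * w)) (hg.comp (by fun_prop) hmaps)
    (fun a ha b hb hab ↦ mul_left_cancel₀ hT0 (hinj (hmaps ha) (hmaps hb) hab))
    (z := z / T) (by linarith)
  rw [deriv_comp_mul_left, mul_div_cancel₀ z hT0, mul_zero, hg0, sub_zero, norm_smul] at key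
  have hle : ‖z / T‖ / (1 - ‖z / T‖) ^ 2 ≤ 4 * ‖z / T‖ := by
    rw [div_le_iff₀ (by nlinarith)]
    nlinarith [norm_nonneg (z / T), mul_nonneg (norm_nonneg (z / T)) (by nlinarith :
      0 ≤ 4 * (1 - ‖z / T‖) ^ 2 - 1)]
  calc ‖g z‖ ≤ ‖T‖ * ‖deriv g 0‖ * (4 * ‖z / T‖) := key.trans (by gcongr)
    _ = _ := by
      rw [norm_div]
      have := norm_ne_zero_iff.2 hT0
      field_simp

/-- A second-order **Schwarz lemma**. -/
theorem norm_le_mul_sq_of_deriv_eq_zero {R C : ℝ} (hR : 0 < R) {ψ : ℂ → ℂ}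
    (hψ : DifferentiableOn ℂ ψ (ball 0 R)) (h0 : ψ 0 = 0) (h1 : deriv ψ 0 = 0)
    (hC : ∀ z ∈ ball (0 : ℂ) R, ‖ψ z‖ ≤ C) {w : ℂ} (hw : w ∈ ball (0 : ℂ) R) :
    ‖ψ w‖ ≤ C * (‖w‖ / R) ^ 2 := by
  have hlit : (ψ · - ψ 0) =o[𝓝 0] (fun w : ℂ ↦ ‖w - 0‖ ^ 1) := by
    have := (hψ.differentiableAt (ball_mem_nhds 0 hR)).hasDerivAt.isLittleO
    simpa [h0, h1] using this.norm_right
  simpa [h0] using Complex.dist_le_mul_div_pow_of_mapsTo_ball_of_isLittleO (n := 1) hψ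
    (fun z hz ↦ by simpa [h0] using hC z hz) hlit hw

end UnivalentDistortion

/-- **Contraction estimate for the rescaled composition operators**
`A(φ) = (g′(0))⁻¹ · φ ∘ g`.
If `g` is injective and holomorphic on the disk of radius `2R` centered at `0`, with
`g 0 = 0` and `0 < ‖g′(0)‖ < 1/17`, then `g` maps the disk of radius `R` into itself, and
for any two bounded holomorphic functions `φ₁, φ₂` on the disk of radius `R` vanishing at
`0` with derivative `1` at `0`, the sup of `‖g′(0)‖⁻¹ · ‖φ₁∘g − φ₂∘g‖` over the disk of
radius `R` is at most `(16/17)` times the sup of `‖φ₁ − φ₂‖` there (formulated via an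
arbitrary upper bound `C` of the latter sup). -/
theorem rescaled_composition_contraction (R : ℝ) (hR : 0 < R) (g : ℂ → ℂ)
    (hg : DifferentiableOn ℂ g (ball (0 : ℂ) (2 * R)))
    (hinj : InjOn g (ball (0 : ℂ) (2 * R)))
    (hg0 : g 0 = 0)
    (hd0 : 0 < ‖deriv g 0‖) (hd1 : ‖deriv g 0‖ < 1 / 17) :
    MapsTo g (ball (0 : ℂ) R) (ball (0 : ℂ) R) ∧
      ∀ φ₁ φ₂ : ℂ → ℂ,
        DifferentiableOn ℂ φ₁ (ball (0 : ℂ) R) →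
        DifferentiableOn ℂ φ₂ (ball (0 : ℂ) R) →
        (∃ M : ℝ, ∀ z ∈ ball (0 : ℂ) R, ‖φ₁ z‖ ≤ M) →
        (∃ M : ℝ, ∀ z ∈ ball (0 : ℂ) R, ‖φ₂ z‖ ≤ M) →
        φ₁ 0 = 0 → φ₂ 0 = 0 → deriv φ₁ 0 = 1 → deriv φ₂ 0 = 1 →
        ∀ C : ℝ, (∀ z ∈ ball (0 : ℂ) R, ‖φ₁ z - φ₂ z‖ ≤ C) →
          ∀ z ∈ ball (0 : ℂ) R,
            ‖deriv g 0‖⁻¹ * ‖φ₁ (g z) - φ₂ (g z)‖ ≤ (16 / 17) * C := by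
  have hgz : ∀ z ∈ ball (0 : ℂ) R, ‖g z‖ ≤ 4 * ‖deriv g 0‖ * ‖z‖ := fun z hz ↦
    UnivalentDistortion.norm_le_four_mul_of_injOn hR hg hinj hg0 (mem_ball_zero_iff.1 hz)
  have hmaps : MapsTo g (ball (0 : ℂ) R) (ball (0 : ℂ) R) := fun z hz ↦ by
    have h1 := hgz z hz
    rw [mem_ball_zero_iff] at hz ⊢
    nlinarith [norm_nonneg z]
  refine ⟨hmaps, fun φ₁ φ₂ h₁ h₂ _ _ h₁0 h₂0 h₁1 h₂1 C hC z hz ↦ ?_⟩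
  have h0 : ball (0 : ℂ) R ∈ nhds 0 := ball_mem_nhds 0 hR
  have hC0 : 0 ≤ C := (norm_nonneg _).trans (hC 0 (mem_ball_self hR))
  have hd : deriv (fun z ↦ φ₁ z - φ₂ z) 0 = 0 := by
    have := ((h₁.differentiableAt h0).hasDerivAt.sub (h₂.differentiableAt h0).hasDerivAt).deriv
    rwa [h₁1, h₂1, sub_self] at this
  have hle : ‖φ₁ (g z) - φ₂ (g z)‖ ≤ C * (‖g z‖ / R) ^ 2 :=
    UnivalentDistortion.norm_le_mul_sq_of_deriv_eq_zero hR (h₁.sub h₂) (by simp [h₁0, h₂0]) hd hC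
      (hmaps hz)
  have hq : ‖g z‖ / R ≤ 4 * ‖deriv g 0‖ := by
    rw [div_le_iff₀ hR]
    refine (hgz z hz).trans ?_
    gcongr
    exact (mem_ball_zero_iff.1 hz).le
  rw [inv_mul_le_iff₀ hd0]
  calc ‖φ₁ (g z) - φ₂ (g z)‖ ≤ C * (4 * ‖deriv g 0‖) ^ 2 := hle.trans (by gcongr)
    _ = ‖deriv g 0‖ * (16 * ‖deriv g 0‖ * C) := by ring
    _ ≤ ‖deriv g 0‖ * (16 / 17 * C) := by
      gcongr
      linarith
end

section
/- Let R > 0 and let g be an injective holomorphic function on the open disk D_{2R}(0) of radius 2R centered at 0 with g(0) = 0. Then for every z with |z| ≤ R one has |g(z)| ≤ 4·|g′(0)|·|z|. -/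
open Metric Set

open Filter Topology Complex MeasureTheory
open scoped ComplexConjugate

/-- The derivative of an injective holomorphic function does not vanish. -/
theorem Set.InjOn.deriv_ne_zero_of_mem_nhds {f : ℂ → ℂ} {s : Set ℂ} {a : ℂ}
    (hinj : InjOn f s) (hf : DifferentiableOn ℂ f s) (hs : s ∈ 𝓝 a) : deriv f a ≠ 0 := by
  have hfa : AnalyticAt ℂ f a := hf.analyticAt hs
  have hF : AnalyticAt ℂ (fun z => f z - f a) a := hfa.sub analyticAt_const
  have hne : ¬ ∀ᶠ z in 𝓝 a, f z - f a = 0 := by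
    intro h
    have h1 : ∀ᶠ z in 𝓝[≠] a, (f z - f a = 0 ∧ z ∈ s) ∧ z ≠ a :=
      ((h.and hs).filter_mono nhdsWithin_le_nhds).and eventually_mem_nhdsWithin
    obtain ⟨z, ⟨h2, h3⟩, h4⟩ := h1.exists
    exact h4 (hinj h3 (mem_of_mem_nhds hs) (sub_eq_zero.1 h2))
  obtain ⟨n, u, hu, hu0, heq⟩ := hF.exists_eventuallyEq_pow_smul_nonzero_iff.2 hne
  have hn0 : n ≠ 0 := by
    rintro rfl
    have := heq.self_of_nhds
    simp at this
    exact hu0 this.symm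
  intro hd
  have hn1 : n ≠ 1 := by
    rintro rfl
    have h1 : HasDerivAt (fun z => (z - a) ^ 1 • u z) (u a) a := by
      convert! (((hasDerivAt_id a).sub_const a).pow 1).smul hu.differentiableAt.hasDerivAt using 1
      simp
    have h2 : HasDerivAt (fun z => f z - f a) 0 a := by
      simpa [hd] using hfa.differentiableAt.hasDerivAt.sub_const (f a)
    exact hu0 (h1.unique (h2.congr_of_eventuallyEq (heq.mono fun _ h => h.symm)))
  set v : ℂ → ℂ := fun z => exp (log (u z / u a) / n) with hv
  have hva : AnalyticAt ℂ v a := by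
    refine AnalyticAt.cexp (AnalyticAt.div (AnalyticAt.clog (hu.div analyticAt_const hu0) ?_)
      analyticAt_const (by exact_mod_cast hn0))
    simp [hu0]
  have hv1 : v a = 1 := by simp [hv, hu0]
  have hvn : ∀ᶠ z in 𝓝 a, v z ^ n = u z / u a := by
    filter_upwards [hu.continuousAt.eventually_ne hu0] with z hz
    rw [hv]
    simp only
    rw [← exp_nat_mul, mul_div_cancel₀ _ (by exact_mod_cast hn0), exp_log (div_ne_zero hz hu0)]
  set q : ℂ → ℂ := fun z => (z - a) * v z with hq
  have hqa : AnalyticAt ℂ q a := (analyticAt_id.sub analyticAt_const).mul hva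
  have hq' : HasStrictDerivAt q 1 a := by
    have h1 : HasDerivAt q 1 a := by
      convert! ((hasDerivAt_id a).sub_const a).mul hva.differentiableAt.hasDerivAt using 1
      simp [hv1]
    simpa [h1.deriv] using hqa.hasStrictDerivAt
  have hqn : ∀ᶠ z in 𝓝 a, f z = f a + u a * q z ^ n := by
    filter_upwards [heq, hvn] with z h1 h2
    rw [hq]
    simp only
    rw [mul_pow, h2, eq_add_of_sub_eq h1, smul_eq_mul]
    field_simp
    ring
  set V := {z | z ∈ s ∧ f z = f a + u a * q z ^ n}
  have hVn : q '' V ∈ 𝓝 (0 : ℂ) := by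
    have h1 : q a = 0 := by simp [hq]
    rw [← h1, ← hq'.map_nhds_eq one_ne_zero]
    exact image_mem_map (inter_mem hs hqn)
  obtain ⟨ω, hω1, hωn⟩ : ∃ ω : ℂ, ω ≠ 1 ∧ ω ^ n = 1 := by
    have := Complex.isPrimitiveRoot_exp n hn0
    exact ⟨_, this.ne_one (by omega), this.pow_eq_one⟩
  have hmul : Tendsto (fun η : ℂ => ω * η) (𝓝 0) (𝓝 0) := by
    have : Continuous (fun η : ℂ => ω * η) := by fun_prop
    simpa using this.tendsto 0
  have h1 : ∀ᶠ η in 𝓝[≠] (0 : ℂ), (η ∈ q '' V ∧ ω * η ∈ q '' V) ∧ η ≠ 0 :=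
    ((Filter.Eventually.and hVn (hmul hVn)).filter_mono nhdsWithin_le_nhds).and
      eventually_mem_nhdsWithin
  obtain ⟨η, ⟨⟨x, ⟨hxs, hx⟩, hxη⟩, ⟨y, ⟨hys, hy⟩, hyη⟩⟩, hη⟩ := h1.exists
  have hxy : x = y := hinj hxs hys (by rw [hx, hy, hxη, hyη, mul_pow, hωn, one_mul])
  rw [hxy, hyη] at hxη
  exact hω1 (mul_right_cancel₀ hη (by rw [hxη, one_mul]))

/-- A nonvanishing holomorphic function on a disk has a holomorphic logarithm. -/
theorem exists_differentiableOn_exp_eq_of_ne_zero {e : ℂ → ℂ} {c : ℂ} {r : ℝ}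
    (he : DifferentiableOn ℂ e (ball c r)) (h0 : ∀ z ∈ ball c r, e z ≠ 0) :
    ∃ l : ℂ → ℂ, DifferentiableOn ℂ l (ball c r) ∧ ∀ z ∈ ball c r, exp (l z) = e z := by
  rcases le_or_gt r 0 with hr | hr
  · simp [ball_eq_empty.2 hr, DifferentiableOn]
  have hc : c ∈ ball c r := mem_ball_self hr
  obtain ⟨l, hlc, hl⟩ := ((he.deriv isOpen_ball).div he h0).isExactOn_ball.with_val_at c (log (e c))
  have key : ∀ z ∈ ball c r, HasDerivAt (fun z => e z * exp (-l z)) 0 z := by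
    intro z hz
    have h1 := (he.differentiableAt (isOpen_ball.mem_nhds hz)).hasDerivAt
    convert! h1.mul (hl z hz).neg.cexp using 1
    have := h0 z hz
    simp only [Pi.div_apply]
    field_simp
    ring
  refine ⟨l, fun z hz => (hl z hz).differentiableAt.differentiableWithinAt, fun z hz => ?_⟩
  have hconst := isOpen_ball.is_const_of_deriv_eq_zero (convex_ball c r).isPreconnected
    (fun z hz => (key z hz).differentiableAt.differentiableWithinAt)
    (fun z hz => (key z hz).deriv) hz hc
  simp only [hlc, exp_neg, exp_log (h0 c hc), mul_inv_cancel₀ (h0 c hc)] at hconst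
  field_simp at hconst
  exact hconst.symm

/-- The area of the image of an injective holomorphic function. -/
theorem measureReal_image_eq_setIntegral_norm_deriv_sq {g g' : ℂ → ℂ} {s : Set ℂ}
    (hs : MeasurableSet s) (hg : ∀ z ∈ s, HasDerivAt g (g' z) z) (hinj : InjOn g s) :
    volume.real (g '' s) = ∫ z in s, ‖g' z‖ ^ 2 := by
  have h1 := integral_image_eq_integral_abs_det_fderiv_smul volume hs
    (fun z hz => ((hg z hz).hasFDerivAt.restrictScalars ℝ).hasFDerivWithinAt) hinj
    (fun _ => (1 : ℝ))
  rw [setIntegral_const, smul_eq_mul, mul_one] at h1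
  rw [h1]
  refine setIntegral_congr_fun hs fun z _ => ?_
  simp [ContinuousLinearMap.det, LinearMap.det_restrictScalars, Algebra.norm_complex_eq,
    Complex.normSq_eq_norm_sq]

/-- Integration over an annulus in polar coordinates. -/
theorem setIntegral_annulus_eq {H : ℂ → ℝ} {r R : ℝ} (hr : 0 < r)
    (hH : ContinuousOn H {z | r ≤ ‖z‖ ∧ ‖z‖ ≤ R}) :
    ∫ z in {z : ℂ | r < ‖z‖ ∧ ‖z‖ < R}, H z =
      ∫ s in Ioo r R, ∫ θ in Ioo (-Real.pi) Real.pi, s * H (circleMap 0 s θ) := by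
  have hA : MeasurableSet {z : ℂ | r < ‖z‖ ∧ ‖z‖ < R} :=
    (measurableSet_lt measurable_const measurable_norm).inter
      (measurableSet_lt measurable_norm measurable_const)
  have hsymm : ∀ p : ℝ × ℝ, Complex.polarCoord.symm p = circleMap 0 p.1 p.2 := by
    intro p
    simp [circleMap, exp_mul_I]
  rw [← integral_indicator hA, ← Complex.integral_comp_polarCoord_symm,
    ← integral_indicator polarCoord.open_target.measurableSet,
    ← setIntegral_prod (fun p : ℝ × ℝ => p.1 * H (circleMap 0 p.1 p.2)),
    ← Measure.volume_eq_prod, ← integral_indicator (measurableSet_Ioo.prod measurableSet_Ioo)]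
  · congr 1
    ext p
    by_cases hp : p ∈ Ioo r R ×ˢ Ioo (-Real.pi) Real.pi
    · have h0 : 0 < p.1 := hr.trans hp.1.1
      rw [indicator_of_mem hp, indicator_of_mem (by exact ⟨h0, hp.2⟩), hsymm,
        indicator_of_mem (by simpa [abs_of_pos h0] using hp.1), smul_eq_mul]
    · rw [indicator_of_notMem hp]
      refine indicator_apply_eq_zero.2 fun hp' => ?_
      have h0 : 0 < p.1 := hp'.1
      rw [hsymm, indicator_of_notMem, smul_zero]
      intro h
      exact hp ⟨by simpa [abs_of_pos h0] using h, hp'.2⟩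
  · have hK : ContinuousOn (fun p : ℝ × ℝ => p.1 * H (circleMap 0 p.1 p.2))
        (Icc r R ×ˢ Icc (-Real.pi) Real.pi) := by
      refine continuousOn_fst.mul (hH.comp ?_ ?_)
      · simp only [circleMap]
        fun_prop
      · intro p hp
        have h0 : 0 < p.1 := hr.trans_le hp.1.1
        simpa [abs_of_pos h0] using hp.1
    exact (hK.integrableOn_compact (μ := volume) (isCompact_Icc.prod isCompact_Icc)).mono_set
      (prod_mono Ioo_subset_Icc_self Ioo_subset_Icc_self)

/-- The mean value property on a circle, for a holomorphic function vanishing at the center. -/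
theorem integral_Ioo_re_circleMap_eq_zero {h : ℂ → ℂ} {s : ℝ} (hs : 0 < s)
    (hh : DifferentiableOn ℂ h (closedBall 0 s)) (h0 : h 0 = 0) :
    ∫ θ in Ioo (-Real.pi) Real.pi, (h (circleMap 0 s θ)).re = 0 := by
  have hcont : Continuous fun θ => h (circleMap 0 s θ) :=
    hh.continuousOn.comp_continuous (continuous_circleMap 0 s)
      fun θ => circleMap_mem_closedBall 0 hs.le θ
  have h1 : Real.circleAverage h 0 s = 0 := by
    have hdc : DifferentiableOn ℂ h (closure (ball 0 |s|)) := by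
      rwa [abs_of_pos hs, closure_ball _ hs.ne']
    exact hdc.diffContOnCl.circleAverage.trans h0
  rw [Real.circleAverage_def, smul_eq_zero_iff_right (by positivity)] at h1
  have hper : Function.Periodic (fun θ => h (circleMap 0 s θ)) (2 * Real.pi) :=
    fun θ => by simp only [periodic_circleMap 0 s θ]
  have h2 := hper.intervalIntegral_add_eq (-Real.pi) 0
  rw [zero_add, h1, show -Real.pi + 2 * Real.pi = Real.pi by ring] at h2
  have h3 := ContinuousLinearMap.intervalIntegral_comp_comm (𝕜 := ℝ) reCLM
    (hcont.intervalIntegrable (μ := volume) (-Real.pi) Real.pi)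
  rw [h2, map_zero, intervalIntegral.integral_of_le (by linarith [Real.pi_pos]),
    integral_Ioc_eq_integral_Ioo] at h3
  exact h3

/-- A lower bound for the area of the image of the annulus `r < ‖z‖ < R` under the injective map
`z ↦ z⁻¹ + φ z`. -/
theorem le_measureReal_image_annulus {φ : ℂ → ℂ} (hφ : DifferentiableOn ℂ φ (ball 0 1))
    (hinj : InjOn (fun z => z⁻¹ + φ z) (ball 0 1 \ {0})) {r R : ℝ} (hr : 0 < r) (hrR : r ≤ R)
    (hR : R < 1) :
    Real.pi * (r⁻¹ ^ 2 - R⁻¹ ^ 2 + ‖deriv φ 0‖ ^ 2 * (R ^ 2 - r ^ 2)) ≤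
      volume.real ((fun z => z⁻¹ + φ z) '' {z : ℂ | r < ‖z‖ ∧ ‖z‖ < R}) := by
  have hA : MeasurableSet {z : ℂ | r < ‖z‖ ∧ ‖z‖ < R} :=
    (measurableSet_lt measurable_const measurable_norm).inter
      (measurableSet_lt measurable_norm measurable_const)
  have hsub : {z : ℂ | r < ‖z‖ ∧ ‖z‖ < R} ⊆ {z : ℂ | r ≤ ‖z‖ ∧ ‖z‖ ≤ R} :=
    fun z hz => ⟨hz.1.le, hz.2.le⟩
  have hsub1 : {z : ℂ | r ≤ ‖z‖ ∧ ‖z‖ ≤ R} ⊆ ball 0 1 :=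
    fun z hz => mem_ball_zero_iff.2 (hz.2.trans_lt hR)
  have hne : ∀ z ∈ {z : ℂ | r ≤ ‖z‖ ∧ ‖z‖ ≤ R}, z ≠ 0 :=
    fun z hz => norm_pos_iff.1 (hr.trans_le hz.1)
  have hsub0 : {z : ℂ | r < ‖z‖ ∧ ‖z‖ < R} ⊆ ball 0 1 \ {0} :=
    fun z hz => ⟨hsub1 (hsub hz), hne z (hsub hz)⟩
  have hcomp : IsCompact {z : ℂ | r ≤ ‖z‖ ∧ ‖z‖ ≤ R} := by
    refine (isCompact_closedBall (0 : ℂ) R).of_isClosed_subset ?_ fun z hz => by simpa using hz.2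
    exact (isClosed_le continuous_const continuous_norm).inter
      (isClosed_le continuous_norm continuous_const)
  set ψ := deriv φ
  have hψd : DifferentiableOn ℂ ψ (ball 0 1) := hφ.deriv isOpen_ball
  have hψc : ContinuousOn ψ {z : ℂ | r ≤ ‖z‖ ∧ ‖z‖ ≤ R} := hψd.continuousOn.mono hsub1
  set b := ψ 0 with hb
  rw [measureReal_image_eq_setIntegral_norm_deriv_sq (g := fun z => z⁻¹ + φ z)
    (g' := fun z => -(z ^ 2)⁻¹ + ψ z) hA
    (fun z hz => (hasDerivAt_inv (hne z (hsub hz))).add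
      (hφ.differentiableAt (isOpen_ball.mem_nhds (hsub1 (hsub hz)))).hasDerivAt)
    (hinj.mono hsub0)]
  set F : ℂ → ℝ := fun z => (‖z‖ ^ 4)⁻¹ + ‖b‖ ^ 2 +
    (2 * conj b * (ψ z - b) - 2 * (((‖z‖ ^ 4)⁻¹ : ℝ) : ℂ) * z ^ 2 * ψ z).re with hF
  have hFc : ContinuousOn F {z : ℂ | r ≤ ‖z‖ ∧ ‖z‖ ≤ R} := by
    have h1 : ContinuousOn (fun z : ℂ => (‖z‖ ^ 4)⁻¹) {z : ℂ | r ≤ ‖z‖ ∧ ‖z‖ ≤ R} :=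
      ContinuousOn.inv₀ (by fun_prop) fun z hz => pow_ne_zero 4 (norm_ne_zero_iff.2 (hne z hz))
    have h2 := continuous_ofReal.comp_continuousOn h1
    refine (h1.add continuousOn_const).add (continuous_re.comp_continuousOn ?_)
    exact (continuousOn_const.mul (hψc.sub continuousOn_const)).sub
      (((continuousOn_const.mul h2).mul (by fun_prop)).mul hψc)
  have hGc : ContinuousOn (fun z => ‖-(z ^ 2)⁻¹ + ψ z‖ ^ 2) {z : ℂ | r ≤ ‖z‖ ∧ ‖z‖ ≤ R} := by
    refine ((ContinuousOn.neg (ContinuousOn.inv₀ (by fun_prop) fun z hz => ?_)).add hψc).norm.pow 2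
    exact pow_ne_zero 2 (hne z hz)
  have hle : ∀ z ∈ {z : ℂ | r < ‖z‖ ∧ ‖z‖ < R}, F z ≤ ‖-(z ^ 2)⁻¹ + ψ z‖ ^ 2 := by
    intro z hz
    have hz0 : z ≠ 0 := hne z (hsub hz)
    have h1 : (z ^ 2)⁻¹ = conj ((((‖z‖ ^ 4)⁻¹ : ℝ) : ℂ) * z ^ 2) := by
      have h2 : (z : ℂ) * conj z = (‖z‖ : ℂ) ^ 2 := mul_conj' z
      have h3 : (‖z‖ : ℂ) ≠ 0 := by exact_mod_cast norm_ne_zero_iff.2 hz0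
      rw [map_mul, conj_ofReal, map_pow]
      push_cast
      field_simp
      linear_combination (-(z * conj z) - (‖z‖ : ℂ) ^ 2) * h2
    have h4 : ‖((((‖z‖ ^ 4)⁻¹ : ℝ) : ℂ) * z ^ 2)‖ ^ 2 = (‖z‖ ^ 4)⁻¹ := by
      rw [norm_mul, norm_pow, Complex.norm_of_nonneg (by positivity)]
      have := norm_pos_iff.2 hz0
      field_simp
    rw [hF]
    simp only
    rw [h1, mul_assoc 2 ((((‖z‖ ^ 4)⁻¹ : ℝ) : ℂ)) (z ^ 2)]
    generalize (((‖z‖ ^ 4)⁻¹ : ℝ) : ℂ) * z ^ 2 = u at h4 ⊢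
    rw [← h4]
    generalize ψ z = p
    simp only [← normSq_eq_norm_sq, normSq_apply, add_re, add_im, mul_re, mul_im, conj_re,
      conj_im, sub_re, sub_im, neg_re, neg_im, re_ofNat, im_ofNat]
    nlinarith [sq_nonneg (p.re - b.re), sq_nonneg (p.im - b.im)]
  refine le_trans (le_of_eq ?_) (setIntegral_mono_on
    ((hFc.integrableOn_compact hcomp).mono_set hsub)
    ((hGc.integrableOn_compact hcomp).mono_set hsub) hA hle)
  rw [setIntegral_annulus_eq hr hFc]
  have hinner : ∀ s ∈ Ioo r R, ∫ θ in Ioo (-Real.pi) Real.pi, s * F (circleMap 0 s θ) =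
      2 * Real.pi * (s ^ 3)⁻¹ + 2 * Real.pi * ‖b‖ ^ 2 * s := by
    intro s hs
    have hs0 : 0 < s := hr.trans hs.1
    have hsub2 : closedBall (0 : ℂ) s ⊆ ball 0 1 := closedBall_subset_ball (hs.2.trans hR)
    set h : ℂ → ℂ := fun z => 2 * conj b * (ψ z - b) - 2 * (((s ^ 4)⁻¹ : ℝ) : ℂ) * z ^ 2 * ψ z
      with hh
    have hhd : DifferentiableOn ℂ h (closedBall 0 s) := by
      have := hψd.mono hsub2
      rw [hh]
      fun_prop
    have hcont : Continuous fun θ => (h (circleMap 0 s θ)).re :=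
      continuous_re.comp (hhd.continuousOn.comp_continuous (continuous_circleMap 0 s)
        fun θ => circleMap_mem_closedBall 0 hs0.le θ)
    have h1 : ∀ θ, s * F (circleMap 0 s θ) =
        s * ((s ^ 4)⁻¹ + ‖b‖ ^ 2) + s * (h (circleMap 0 s θ)).re := by
      intro θ
      simp only [hF, hh, norm_circleMap_zero, abs_of_pos hs0]
      ring
    simp only [h1]
    rw [integral_add, integral_const_mul s (fun θ => (h (circleMap 0 s θ)).re),
      integral_Ioo_re_circleMap_eq_zero hs0 hhd (by simp [hh, hb]), setIntegral_const, mul_zero,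
      add_zero, Real.volume_real_Ioo_of_le (by linarith [Real.pi_pos])]
    · rw [smul_eq_mul]
      field_simp
      ring
    · exact (continuous_const.integrableOn_Icc).mono_set Ioo_subset_Icc_self
    · exact ((continuous_const.mul hcont).integrableOn_Icc).mono_set Ioo_subset_Icc_self
  rw [setIntegral_congr_fun measurableSet_Ioo hinner, ← integral_Ioc_eq_integral_Ioo,
    ← intervalIntegral.integral_of_le hrR]
  have hFTC : ∀ s ∈ uIcc r R, HasDerivAt
      (fun s => -Real.pi * s⁻¹ ^ 2 + Real.pi * ‖b‖ ^ 2 * s ^ 2)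
      (2 * Real.pi * (s ^ 3)⁻¹ + 2 * Real.pi * ‖b‖ ^ 2 * s) s := by
    intro s hs
    rw [uIcc_of_le hrR] at hs
    have hs0 : s ≠ 0 := (hr.trans_le hs.1).ne'
    convert! (((hasDerivAt_inv hs0).pow 2).const_mul (-Real.pi)).add
      (((hasDerivAt_id s).pow 2).const_mul (Real.pi * ‖b‖ ^ 2)) using 1
    simp
    field_simp
  rw [intervalIntegral.integral_eq_sub_of_hasDerivAt hFTC]
  · ring
  · refine ContinuousOn.intervalIntegrable ?_
    rw [uIcc_of_le hrR]
    refine (continuousOn_const.mul (ContinuousOn.inv₀ (by fun_prop) fun s hs => ?_)).add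
      (by fun_prop)
    exact pow_ne_zero 3 (hr.trans_le hs.1).ne'

/-- The image of the annulus `r < ‖z‖ < 1` under the injective map `z ↦ z⁻¹ + φ z` lies in the
convex hull of the image of the circle `‖ζ‖ = r`: no real-linear functional separates them. -/
theorem exists_norm_eq_re_mul_sub_nonpos {φ : ℂ → ℂ} (hφ : DifferentiableOn ℂ φ (ball 0 1))
    (hinj : InjOn (fun z => z⁻¹ + φ z) (ball 0 1 \ {0})) {r : ℝ} (hr : 0 < r) {z : ℂ}
    (hrz : r < ‖z‖) (hz : ‖z‖ < 1) (c : ℂ) :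
    ∃ ζ : ℂ, ‖ζ‖ = r ∧ (c * (z⁻¹ + φ z - (ζ⁻¹ + φ ζ))).re ≤ 0 := by
  by_contra! h
  have hsub : closedBall (0 : ℂ) r ⊆ ball 0 1 := closedBall_subset_ball (hrz.trans hz)
  set w := z⁻¹ + φ z
  set p : ℂ → ℂ := fun ζ => w * ζ - 1 - ζ * φ ζ with hp
  have hc : c ≠ 0 := by
    rintro rfl
    simpa using h r (by simp [abs_of_pos hr])
  have hpG : ∀ ζ : ℂ, ζ ≠ 0 → p ζ = ζ * (w - (ζ⁻¹ + φ ζ)) := by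
    intro ζ hζ
    rw [hp]
    field_simp
    ring
  have hp0 : ∀ ζ ∈ closedBall (0 : ℂ) r, p ζ ≠ 0 := by
    intro ζ hζ
    by_cases hζ0 : ζ = 0
    · simp [hp, hζ0]
    · rw [hpG ζ hζ0]
      refine mul_ne_zero hζ0 (sub_ne_zero.2 fun heq => ?_)
      have := hinj ⟨mem_ball_zero_iff.2 hz, norm_pos_iff.1 (hr.trans hrz)⟩ ⟨hsub hζ, hζ0⟩ heq
      rw [← this, mem_closedBall_zero_iff] at hζ
      linarith
  set k : ℂ → ℂ := fun ζ => exp (-(ζ / (c * p ζ))) with hk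
  have hkd : DifferentiableOn ℂ k (closedBall 0 r) := by
    have h1 := hφ.mono hsub
    have h2 : DifferentiableOn ℂ p (closedBall 0 r) := by
      rw [hp]
      fun_prop
    exact ((differentiableOn_id.div (h2.const_mul c)
      fun ζ hζ => mul_ne_zero hc (hp0 ζ hζ)).neg).cexp
  rw [← closure_ball (0 : ℂ) hr.ne'] at hkd
  obtain ⟨ζ, hζ, hmax⟩ := exists_mem_frontier_isMaxOn_norm isBounded_ball
    (nonempty_ball.2 hr) hkd.diffContOnCl
  rw [frontier_ball (0 : ℂ) hr.ne', mem_sphere_zero_iff_norm] at hζ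
  have h1 : ‖k 0‖ ≤ ‖k ζ‖ := hmax (subset_closure (mem_ball_self hr))
  have hζ0 : ζ ≠ 0 := norm_pos_iff.1 (hζ ▸ hr)
  have h2 := h ζ hζ
  have h3 : ζ / (c * p ζ) = (c * (w - (ζ⁻¹ + φ ζ)))⁻¹ := by
    rw [hpG ζ hζ0, mul_left_comm, div_mul_cancel_left₀ hζ0]
  simp only [hk, norm_exp, zero_div, neg_zero, zero_re, Real.exp_zero, h3, neg_re, inv_re] at h1
  rw [Real.one_le_exp_iff, Left.nonneg_neg_iff] at h1
  have h4 : 0 < normSq (c * (w - (ζ⁻¹ + φ ζ))) := normSq_pos.2 fun h5 => by simp [h5] at h2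
  exact absurd h1 (not_le.2 (div_pos h2 h4))

/-- The image of the annulus `r < ‖z‖ < 1` under the injective map `z ↦ z⁻¹ + φ z` lies in an
explicit ellipse. -/
theorem norm_sub_mul_conj_le_of_injOn {φ : ℂ → ℂ} (hφ : DifferentiableOn ℂ φ (ball 0 1))
    (hinj : InjOn (fun z => z⁻¹ + φ z) (ball 0 1 \ {0})) {r δ : ℝ} (hr : 0 < r) {b : ℂ}
    (hb : ‖b‖ * r ^ 2 ≤ 1) (hδ : ∀ ζ : ℂ, ‖ζ‖ = r → ‖φ ζ - φ 0 - b * ζ‖ ≤ δ) {z : ℂ}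
    (hrz : r < ‖z‖) (hz : ‖z‖ < 1) :
    ‖(z⁻¹ + φ z - φ 0) - b * r ^ 2 * conj (z⁻¹ + φ z - φ 0)‖ ≤ r⁻¹ + 2 * δ := by
  set m := (z⁻¹ + φ z - φ 0) - b * r ^ 2 * conj (z⁻¹ + φ z - φ 0) with hm
  obtain ⟨ζ, hζ, hre⟩ := exists_norm_eq_re_mul_sub_nonpos hφ hinj hr hrz hz
    (conj m - m * conj b * r ^ 2)
  set x := ζ⁻¹ + φ ζ - φ 0 with hx
  have hζ0 : ζ ≠ 0 := norm_pos_iff.1 (hζ ▸ hr)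
  have hrc : (r : ℂ) ≠ 0 := by exact_mod_cast hr.ne'
  have hdual : ∀ y : ℂ, ((conj m - m * conj b * r ^ 2) * y).re =
      (conj m * (y - b * r ^ 2 * conj y)).re := by
    intro y
    simp only [← ofReal_pow, mul_re, mul_im, sub_re, sub_im, conj_re, conj_im, ofReal_re,
      ofReal_im]
    ring
  have hMx : ‖x - b * r ^ 2 * conj x‖ ≤ r⁻¹ + 2 * δ := by
    set ε := φ ζ - φ 0 - b * ζ with hε
    have hεδ : ‖ε‖ ≤ δ := hδ ζ hζ
    have hconj : conj ζ = r ^ 2 * ζ⁻¹ := by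
      have := mul_conj' ζ
      rw [hζ] at this
      field_simp
      linear_combination this
    have h1 : x - b * r ^ 2 * conj x =
        ((1 - (‖b‖ * r ^ 2) ^ 2 : ℝ) : ℂ) * ζ⁻¹ + ε - b * r ^ 2 * conj ε := by
      have h2 : x = ζ⁻¹ + b * ζ + ε := by rw [hx, hε]; ring
      have h3 := mul_conj' b
      rw [h2]
      simp only [map_add, map_mul, map_inv₀, hconj]
      push_cast
      field_simp
      linear_combination (-(r : ℂ) ^ 4) * h3
    have h4 : ‖((1 - (‖b‖ * r ^ 2) ^ 2 : ℝ) : ℂ) * ζ⁻¹‖ ≤ r⁻¹ := by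
      have h5 : 0 ≤ ‖b‖ * r ^ 2 := by positivity
      rw [norm_mul, norm_inv, hζ, Complex.norm_of_nonneg (by nlinarith)]
      exact mul_le_of_le_one_left (by positivity) (by nlinarith)
    have h6 : ‖b * r ^ 2 * conj ε‖ ≤ δ := by
      rw [norm_mul, norm_mul, norm_pow, RCLike.norm_conj, Complex.norm_of_nonneg hr.le]
      exact (mul_le_of_le_one_left (norm_nonneg _) hb).trans hεδ
    rw [h1]
    linarith [norm_sub_le (((1 - (‖b‖ * r ^ 2) ^ 2 : ℝ) : ℂ) * ζ⁻¹ + ε) (b * r ^ 2 * conj ε),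
      norm_add_le (((1 - (‖b‖ * r ^ 2) ^ 2 : ℝ) : ℂ) * ζ⁻¹) ε]
  have hsq : ‖m‖ ^ 2 ≤ ‖m‖ * ‖x - b * r ^ 2 * conj x‖ := by
    have h1 : z⁻¹ + φ z - (ζ⁻¹ + φ ζ) = (z⁻¹ + φ z - φ 0) - x := by rw [hx]; ring
    rw [h1, mul_sub, sub_re, hdual, hdual, ← hm, conj_mul', ← ofReal_pow, ofReal_re] at hre
    have h2 := re_le_norm (conj m * (x - b * r ^ 2 * conj x))
    rw [norm_mul, RCLike.norm_conj] at h2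
    linarith
  refine le_trans ?_ hMx
  rcases (norm_nonneg m).eq_or_lt with h0 | h0
  · rw [← h0]
    exact norm_nonneg _
  · exact le_of_mul_le_mul_left (by rwa [← sq]) h0

/-- The area of an ellipse. -/
theorem measureReal_setOf_norm_sub_mul_conj_le {β : ℂ} (hβ : ‖β‖ < 1) (c : ℂ) {ρ : ℝ}
    (hρ : 0 ≤ ρ) :
    volume.real {w : ℂ | ‖(w - c) - β * conj (w - c)‖ ≤ ρ} =
      Real.pi * ρ ^ 2 / (1 - ‖β‖ ^ 2) := by
  set L : ℂ →ₗ[ℝ] ℂ := LinearMap.id - LinearMap.mulLeft ℝ β ∘ₗ conjAe.toLinearMap with hL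
  have hdet : LinearMap.det L = 1 - ‖β‖ ^ 2 := by
    rw [← LinearMap.det_toMatrix basisOneI, Matrix.det_fin_two]
    simp [LinearMap.toMatrix_apply, hL, ← normSq_eq_norm_sq, normSq_apply]
    ring
  have hpos : 0 < 1 - ‖β‖ ^ 2 := by nlinarith [norm_nonneg β]
  have hset : {w : ℂ | ‖(w - c) - β * conj (w - c)‖ ≤ ρ} =
      (fun w => w + -c) ⁻¹' (L ⁻¹' closedBall 0 ρ) := by
    ext w
    simp [hL, sub_eq_add_neg]
  rw [hset, measureReal_def, measure_preimage_add_right,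
    Measure.addHaar_preimage_linearMap _ (by rw [hdet]; exact hpos.ne'), hdet,
    Complex.volume_closedBall, abs_of_pos (inv_pos.2 hpos)]
  simp only [ENNReal.toReal_mul, ENNReal.toReal_pow, ENNReal.toReal_ofReal hρ,
    ENNReal.toReal_ofReal (inv_pos.2 hpos).le, ENNReal.coe_toReal, NNReal.coe_real_pi]
  field_simp

/-- The first coefficient estimate of **Gronwall's area theorem**. -/
theorem norm_deriv_le_one_of_injOn_inv_add {φ : ℂ → ℂ} (hφ : DifferentiableOn ℂ φ (ball 0 1))
    (hinj : InjOn (fun z => z⁻¹ + φ z) (ball 0 1 \ {0})) : ‖deriv φ 0‖ ≤ 1 := by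
  have hnhds : ball (0 : ℂ) 1 ∈ 𝓝 (0 : ℂ) := ball_mem_nhds 0 one_pos
  set b := deriv φ 0 with hb
  obtain ⟨C, hC0, hC⟩ : ∃ C : ℝ, 0 ≤ C ∧
      ∀ᶠ ζ in 𝓝 (0 : ℂ), ‖φ ζ - φ 0 - b * ζ‖ ≤ C * ‖ζ‖ ^ 2 := by
    have h1 : DifferentiableOn ℂ (dslope (dslope φ 0) 0) (ball 0 1) :=
      (differentiableOn_dslope hnhds).2 ((differentiableOn_dslope hnhds).2 hφ)
    have h2 := ((h1.differentiableAt hnhds).continuousAt.norm.eventually_le_const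
      (lt_add_one _))
    refine ⟨‖dslope (dslope φ 0) 0 0‖ + 1, by positivity, ?_⟩
    filter_upwards [h2] with ζ hζ
    have h3 := sub_smul_dslope φ 0 ζ
    have h4 := sub_smul_dslope (dslope φ 0) 0 ζ
    rw [dslope_same, ← hb] at h4
    simp only [sub_zero, smul_eq_mul] at h3 h4
    have h5 : φ ζ - φ 0 - b * ζ = dslope (dslope φ 0) 0 ζ * ζ ^ 2 := by
      linear_combination -h3 - ζ * h4
    rw [h5, norm_mul, norm_pow]
    gcongr
  have hlim : ∀ R ∈ Ioo (0 : ℝ) 1, ‖b‖ ^ 2 * R ^ 2 - R⁻¹ ^ 2 ≤ 0 := by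
    intro R hR
    have hev : ∀ᶠ r in 𝓝[>] (0 : ℝ),
        (‖b‖ ^ 2 * (R ^ 2 - r ^ 2) - R⁻¹ ^ 2) * (1 - (‖b‖ * r ^ 2) ^ 2) - ‖b‖ ^ 2 * r ^ 2 ≤
          4 * C * r + 4 * C ^ 2 * r ^ 4 := by
      obtain ⟨η, hη, hηC⟩ := Metric.eventually_nhds_iff.1 hC
      have hsmall : ∀ᶠ r in 𝓝[>] (0 : ℝ), ‖b‖ * r ^ 2 < 1 := by
        refine (Tendsto.eventually_lt_const (u := 1) (v := ‖b‖ * 0 ^ 2) (by simp) ?_)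
        exact (Continuous.tendsto (by fun_prop) 0).mono_left nhdsWithin_le_nhds
      filter_upwards [hsmall, Ioo_mem_nhdsGT hη, Ioo_mem_nhdsGT hR.1] with r hbr hrη hrR
      have hr : 0 < r := hrη.1
      have hbr0 : 0 ≤ ‖b‖ * r ^ 2 := by positivity
      have hpos : 0 < 1 - (‖b‖ * r ^ 2) ^ 2 := by nlinarith
      have hδ : ∀ ζ : ℂ, ‖ζ‖ = r → ‖φ ζ - φ 0 - b * ζ‖ ≤ C * r ^ 2 := by
        intro ζ hζ
        rw [← hζ]
        exact hηC (by rw [dist_zero_right, hζ]; exact hrη.2)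
      have hnβ : ‖b * (r : ℂ) ^ 2‖ = ‖b‖ * r ^ 2 := by
        rw [norm_mul, norm_pow, Complex.norm_of_nonneg hr.le]
      have hvol := measureReal_setOf_norm_sub_mul_conj_le (β := b * (r : ℂ) ^ 2)
        (hnβ.trans_lt hbr) (φ 0) (ρ := r⁻¹ + 2 * (C * r ^ 2)) (by positivity)
      rw [hnβ] at hvol
      have hle := (le_measureReal_image_annulus hφ hinj hr hrR.2.le hR.2).trans
        (measureReal_mono (s₂ := {w : ℂ | ‖(w - φ 0) - b * (r : ℂ) ^ 2 * conj (w - φ 0)‖ ≤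
          r⁻¹ + 2 * (C * r ^ 2)}) (by
            rintro _ ⟨z, hz, rfl⟩
            exact norm_sub_mul_conj_le_of_injOn hφ hinj hr hbr.le hδ hz.1 (hz.2.trans hR.2))
          (fun htop => by
            rw [measureReal_def, htop, ENNReal.toReal_top] at hvol
            exact (by positivity : Real.pi * (r⁻¹ + 2 * (C * r ^ 2)) ^ 2 /
              (1 - (‖b‖ * r ^ 2) ^ 2) ≠ 0) hvol.symm))
      rw [hvol, mul_div_assoc, mul_le_mul_iff_right₀ Real.pi_pos, le_div_iff₀ hpos, ← hb] at hle
      have h1 : (r⁻¹ ^ 2 - R⁻¹ ^ 2 + ‖b‖ ^ 2 * (R ^ 2 - r ^ 2)) * (1 - (‖b‖ * r ^ 2) ^ 2) =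
          r⁻¹ ^ 2 + ((‖b‖ ^ 2 * (R ^ 2 - r ^ 2) - R⁻¹ ^ 2) * (1 - (‖b‖ * r ^ 2) ^ 2) -
            ‖b‖ ^ 2 * r ^ 2) := by
        field_simp
        ring
      have h2 : (r⁻¹ + 2 * (C * r ^ 2)) ^ 2 = r⁻¹ ^ 2 + (4 * C * r + 4 * C ^ 2 * r ^ 4) := by
        field_simp
        ring
      rw [h1, h2] at hle
      exact le_of_add_le_add_left hle
    have h1 : Tendsto (fun r : ℝ => (‖b‖ ^ 2 * (R ^ 2 - r ^ 2) - R⁻¹ ^ 2) *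
        (1 - (‖b‖ * r ^ 2) ^ 2) - ‖b‖ ^ 2 * r ^ 2) (𝓝[>] 0) (𝓝 (‖b‖ ^ 2 * R ^ 2 - R⁻¹ ^ 2)) := by
      refine Tendsto.mono_left ?_ nhdsWithin_le_nhds
      exact Continuous.tendsto' (by fun_prop) _ _ (by simp)
    have h2 : Tendsto (fun r : ℝ => 4 * C * r + 4 * C ^ 2 * r ^ 4) (𝓝[>] 0) (𝓝 0) := by
      refine Tendsto.mono_left ?_ nhdsWithin_le_nhds
      exact Continuous.tendsto' (by fun_prop) _ _ (by simp)
    exact le_of_tendsto_of_tendsto h1 h2 hev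
  have hlim1 : ‖b‖ ^ 2 * 1 ^ 2 - (1 : ℝ)⁻¹ ^ 2 ≤ 0 := by
    have h1 : Tendsto (fun R : ℝ => ‖b‖ ^ 2 * R ^ 2 - R⁻¹ ^ 2) (𝓝[<] 1)
        (𝓝 (‖b‖ ^ 2 * 1 ^ 2 - (1 : ℝ)⁻¹ ^ 2)) := by
      refine Tendsto.mono_left ?_ nhdsWithin_le_nhds
      exact (tendsto_const_nhds.mul (tendsto_id.pow 2)).sub
        ((tendsto_inv₀ one_ne_zero).pow 2)
    exact le_of_tendsto h1 (eventually_of_mem (Ioo_mem_nhdsLT one_pos) hlim)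
  nlinarith [norm_nonneg b]

/-- **Bieberbach's inequality** for the second coefficient of a univalent function. -/
theorem norm_deriv_deriv_le_of_injOn {f : ℂ → ℂ} (hf : DifferentiableOn ℂ f (ball 0 1))
    (hinj : InjOn f (ball 0 1)) (hf0 : f 0 = 0) :
    ‖deriv (deriv f) 0‖ ≤ 4 * ‖deriv f 0‖ := by
  have h0 : (0 : ℂ) ∈ ball (0 : ℂ) 1 := mem_ball_self one_pos
  have hnhds : ball (0 : ℂ) 1 ∈ 𝓝 (0 : ℂ) := isOpen_ball.mem_nhds h0
  have he0 : ∀ z ∈ ball (0 : ℂ) 1, dslope f 0 z ≠ 0 := by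
    intro z hz
    by_cases hz0 : z = 0
    · rw [hz0, dslope_same]
      exact hinj.deriv_ne_zero_of_mem_nhds hf hnhds
    · rw [dslope_of_ne _ hz0, slope_def_field, hf0, sub_zero, sub_zero]
      exact div_ne_zero (fun h => hz0 (hinj hz h0 (h.trans hf0.symm))) hz0
  obtain ⟨l, hl, hle⟩ := exists_differentiableOn_exp_eq_of_ne_zero
    ((differentiableOn_dslope hnhds).2 hf) he0
  have hfl : ∀ z ∈ ball (0 : ℂ) 1, f z = z * exp (l z) := by
    intro z hz
    rw [hle z hz]
    simpa [hf0] using (sub_smul_dslope f 0 z).symm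
  have hl0 : HasDerivAt l (deriv l 0) 0 := (hl.differentiableAt hnhds).hasDerivAt
  have hf' : ∀ z ∈ ball (0 : ℂ) 1, deriv f z = exp (l z) * (1 + z * deriv l z) := by
    intro z hz
    have h1 := (hl.differentiableAt (isOpen_ball.mem_nhds hz)).hasDerivAt
    have h2 : HasDerivAt (fun z => z * exp (l z)) (exp (l z) * (1 + z * deriv l z)) z := by
      convert! (hasDerivAt_id z).mul h1.cexp using 1
      simp only [id]
      ring
    exact (h2.congr_of_eventuallyEq (eventually_of_mem (isOpen_ball.mem_nhds hz) hfl)).deriv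
  have hf'' : deriv (deriv f) 0 = 2 * exp (l 0) * deriv l 0 := by
    have h1 := ((hl.deriv isOpen_ball).differentiableAt hnhds).hasDerivAt
    have h2 : HasDerivAt (fun z => exp (l z) * (1 + z * deriv l z))
        (2 * exp (l 0) * deriv l 0) 0 := by
      convert! hl0.cexp.mul (((hasDerivAt_id (0 : ℂ)).mul h1).const_add 1) using 1
      simp
      ring
    exact (h2.congr_of_eventuallyEq (eventually_of_mem hnhds hf')).deriv
  set t : ℂ → ℂ := fun z => exp (-(l z - l 0) / 2) with ht
  have htd : DifferentiableOn ℂ t (ball 0 1) := by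
    rw [ht]
    fun_prop
  have ht0 : t 0 = 1 := by simp [ht]
  have ht' : HasDerivAt t (-deriv l 0 / 2) 0 := by
    convert! ((hl0.sub_const (l 0)).neg.div_const 2).cexp using 1
    simp
  have hsq : MapsTo (fun z : ℂ => z ^ 2) (ball 0 1) (ball 0 1) := by
    intro z hz
    rw [mem_ball_zero_iff] at hz ⊢
    rw [norm_pow]
    exact pow_lt_one₀ (norm_nonneg _) hz two_ne_zero
  have hdd : DifferentiableOn ℂ (fun z => dslope t 0 (z ^ 2)) (ball 0 1) :=
    ((differentiableOn_dslope hnhds).2 htd).comp (by fun_prop) hsq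
  have hG : ∀ z : ℂ, z ≠ 0 → z⁻¹ + z * dslope t 0 (z ^ 2) = z⁻¹ * t (z ^ 2) := by
    intro z hz
    have := sub_smul_dslope t 0 (z ^ 2)
    rw [ht0, sub_zero, smul_eq_mul] at this
    field_simp
    linear_combination this
  have hG2 : ∀ z ∈ ball (0 : ℂ) 1, z ≠ 0 → (z⁻¹ * t (z ^ 2)) ^ 2 = exp (l 0) / f (z ^ 2) := by
    intro z hz hz0
    rw [hfl _ (hsq hz), mul_pow, ht]
    simp only
    rw [← exp_nat_mul, inv_pow, inv_mul_eq_div, div_eq_div_iff (by positivity)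
      (mul_ne_zero (by positivity) (exp_ne_zero _)), mul_left_comm, ← exp_add, mul_comm]
    congr 2
    push_cast
    ring
  have key := norm_deriv_le_one_of_injOn_inv_add (φ := fun z => z * dslope t 0 (z ^ 2))
    (differentiableOn_id.mul hdd) (by
      rintro z ⟨hz, hz0⟩ w ⟨hw, hw0⟩ h
      rw [mem_singleton_iff] at hz0 hw0
      simp only [hG z hz0, hG w hw0] at h
      have h1 := congrArg (· ^ 2) h
      simp only [hG2 z hz hz0, hG2 w hw hw0] at h1
      have h2 : f (z ^ 2) = f (w ^ 2) := by
        simpa [div_eq_mul_inv] using h1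
      rcases sq_eq_sq_iff_eq_or_eq_neg.1 (hinj (hsq hz) (hsq hw) h2) with h3 | h3
      · exact h3
      · subst h3
        rw [neg_sq, inv_neg, neg_mul] at h
        have h4 : w⁻¹ * t (w ^ 2) = 0 := by linear_combination (-1 / 2 : ℂ) * h
        exact absurd h4 (mul_ne_zero (inv_ne_zero hw0) (exp_ne_zero _)))
  have hφ' : deriv (fun z => z * dslope t 0 (z ^ 2)) 0 = -deriv l 0 / 2 := by
    have h1 := (hdd.differentiableAt hnhds).hasDerivAt
    have h2 := ((hasDerivAt_id (0 : ℂ)).mul h1).deriv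
    simpa [ht'.deriv, Pi.mul_def] using h2
  rw [hφ', norm_div, norm_neg, Complex.norm_ofNat, div_le_one two_pos] at key
  rw [hf'', hf' 0 h0, norm_mul, norm_mul, Complex.norm_ofNat]
  simp only [zero_mul, add_zero, mul_one]
  nlinarith [norm_nonneg (exp (l 0))]

/-- Bieberbach's inequality for the Koebe transform of `f` at `a`. -/
theorem norm_deriv_deriv_sub_le_of_injOn {f : ℂ → ℂ} (hf : DifferentiableOn ℂ f (ball 0 1))
    (hinj : InjOn f (ball 0 1)) {a : ℂ} (ha : ‖a‖ < 1) :
    ‖(1 - ‖a‖ ^ 2) * deriv (deriv f) a - 2 * conj a * deriv f a‖ ≤ 4 * ‖deriv f a‖ := by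
  have hden : ∀ z ∈ ball (0 : ℂ) 1, 1 + conj a * z ≠ 0 := by
    intro z hz h
    rw [mem_ball_zero_iff] at hz
    have h1 : ‖conj a * z‖ = 1 := by rw [eq_neg_of_add_eq_zero_right h, norm_neg, norm_one]
    rw [norm_mul, RCLike.norm_conj] at h1
    nlinarith [norm_nonneg a, norm_nonneg z]
  have hnormSq : conj a * a = (‖a‖ : ℂ) ^ 2 := conj_mul' a
  have hpos : 0 < 1 - ‖a‖ ^ 2 := by nlinarith [norm_nonneg a]
  have hpos' : (1 - (‖a‖ : ℂ) ^ 2) ≠ 0 := by exact_mod_cast hpos.ne'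
  set m : ℂ → ℂ := fun z => (z + a) / (1 + conj a * z) with hm
  have hm0 : m 0 = a := by simp [hm]
  have hmaps : MapsTo m (ball 0 1) (ball 0 1) := by
    intro z hz
    have h1 := norm_pos_iff.2 (hden z hz)
    rw [mem_ball_zero_iff] at hz ⊢
    rw [hm, norm_div, div_lt_one h1, ← sq_lt_sq₀ (norm_nonneg _) (norm_nonneg _)]
    have h2 : ‖1 + conj a * z‖ ^ 2 - ‖z + a‖ ^ 2 = (1 - ‖a‖ ^ 2) * (1 - ‖z‖ ^ 2) := by
      simp only [← normSq_eq_norm_sq, normSq_apply, add_re, add_im, mul_re, mul_im, conj_re,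
        conj_im, one_re, one_im]
      ring
    have h3 : 0 < 1 - ‖z‖ ^ 2 := by nlinarith [norm_nonneg z]
    nlinarith [mul_pos hpos h3]
  have hminj : InjOn m (ball 0 1) := by
    intro z hz w hw h
    rw [hm] at h
    simp only at h
    rw [div_eq_div_iff (hden z hz) (hden w hw)] at h
    have h1 : (z - w) * (1 - (‖a‖ : ℂ) ^ 2) = 0 := by
      rw [← hnormSq]
      linear_combination h
    exact sub_eq_zero.1 ((mul_eq_zero.1 h1).resolve_right hpos')
  have hm' : ∀ z ∈ ball (0 : ℂ) 1,
      HasDerivAt m ((1 - (‖a‖ : ℂ) ^ 2) / (1 + conj a * z) ^ 2) z := by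
    intro z hz
    convert! ((hasDerivAt_id z).add_const a).div
      (((hasDerivAt_id z).const_mul (conj a)).const_add 1) (hden z hz) using 1
    rw [← hnormSq]
    simp only [id]
    ring
  have hmd : DifferentiableOn ℂ m (ball 0 1) :=
    fun z hz => (hm' z hz).differentiableAt.differentiableWithinAt
  have h0 : (0 : ℂ) ∈ ball (0 : ℂ) 1 := mem_ball_self one_pos
  have hnhds : ball (0 : ℂ) 1 ∈ 𝓝 (0 : ℂ) := isOpen_ball.mem_nhds h0
  have hk' : ∀ z ∈ ball (0 : ℂ) 1, deriv (fun z => f (m z) - f a) z =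
      deriv f (m z) * ((1 - (‖a‖ : ℂ) ^ 2) / (1 + conj a * z) ^ 2) := by
    intro z hz
    have h1 := (hf.differentiableAt (isOpen_ball.mem_nhds (hmaps hz))).hasDerivAt
    exact ((h1.comp z (hm' z hz)).sub_const (f a)).deriv
  have hk'' : deriv (deriv (fun z => f (m z) - f a)) 0 =
      (1 - (‖a‖ : ℂ) ^ 2) * ((1 - ‖a‖ ^ 2) * deriv (deriv f) a - 2 * conj a * deriv f a) := by
    have h1 : HasDerivAt (deriv f) (deriv (deriv f) a) (m 0) := by
      rw [hm0]
      exact ((hf.deriv isOpen_ball).differentiableAt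
        (isOpen_ball.mem_nhds (mem_ball_zero_iff.2 ha))).hasDerivAt
    have h2 : HasDerivAt (fun z => (1 - (‖a‖ : ℂ) ^ 2) / (1 + conj a * z) ^ 2)
        (-2 * conj a * (1 - (‖a‖ : ℂ) ^ 2)) 0 := by
      convert! (hasDerivAt_const (0 : ℂ) (1 - (‖a‖ : ℂ) ^ 2)).div
        ((((hasDerivAt_id (0 : ℂ)).const_mul (conj a)).const_add 1).pow 2) (by simp) using 1
      simp
      ring
    have h3 := (h1.comp 0 (hm' 0 h0)).mul h2
    refine ((h3.congr_of_eventuallyEq (eventually_of_mem hnhds hk')).deriv).trans ?_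
    simp [hm0]
    ring
  have key := norm_deriv_deriv_le_of_injOn (f := fun z => f (m z) - f a)
    ((hf.comp hmd hmaps).sub_const _)
    (fun z hz w hw h => hminj hz hw (hinj (hmaps hz) (hmaps hw) (sub_left_inj.1 h)))
    (by simp [hm0])
  have hn : ‖1 - (‖a‖ : ℂ) ^ 2‖ = 1 - ‖a‖ ^ 2 := by
    rw [← Complex.norm_of_nonneg hpos.le]
    push_cast
    rfl
  rw [hk'', hk' 0 h0, hm0, norm_mul, norm_mul, mul_zero, add_zero, one_pow, div_one, hn] at key
  refine le_of_mul_le_mul_left (key.trans_eq ?_) hpos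
  ring

/-- The upper bound of the **Koebe distortion theorem**. -/
theorem norm_deriv_le_of_injOn {f : ℂ → ℂ} (hf : DifferentiableOn ℂ f (ball 0 1))
    (hinj : InjOn f (ball 0 1)) {z : ℂ} (hz : ‖z‖ < 1) :
    ‖deriv f z‖ ≤ ‖deriv f 0‖ * ((1 + ‖z‖) / (1 - ‖z‖) ^ 3) := by
  rcases eq_or_ne z 0 with rfl | hz0
  · simp
  set e : ℂ := z / ‖z‖ with he
  have hzn : 0 < ‖z‖ := norm_pos_iff.2 hz0
  have hen : ‖e‖ = 1 := by simp [he, hzn.ne']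
  have hze : (‖z‖ : ℂ) * e = z := by
    rw [he, mul_div_cancel₀]
    exact_mod_cast hzn.ne'
  have hnorm : ∀ s : ℝ, 0 ≤ s → ‖(s : ℂ) * e‖ = s := by
    intro s hs
    rw [norm_mul, hen, mul_one, Complex.norm_of_nonneg hs]
  have hd : ∀ s ∈ Ico (0 : ℝ) 1, HasDerivAt (fun s : ℝ => deriv f (s * e))
      (deriv (deriv f) (s * e) * e) s := by
    intro s hs
    have h1 : ((s : ℂ) * e) ∈ ball (0 : ℂ) 1 := by
      rw [mem_ball_zero_iff, hnorm s hs.1]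
      exact hs.2
    have h2 := ((hf.deriv isOpen_ball).differentiableAt (isOpen_ball.mem_nhds h1)).hasDerivAt
    have h3 : HasDerivAt (fun s : ℝ => (s : ℂ) * e) e s := by
      simpa using (ofRealCLM.hasDerivAt (x := s)).mul_const e
    exact h2.comp s h3
  set W : ℝ → ℝ := fun s => ((1 - s) ^ 3 / (1 + s)) ^ 2 with hW
  have hWd : ∀ s ∈ Ico (0 : ℝ) 1,
      HasDerivAt W (-2 * (4 + 2 * s) * (1 - s) ^ 5 / (1 + s) ^ 3) s := by
    intro s hs
    have h1 : 1 + s ≠ 0 := by linarith [hs.1]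
    convert! ((((hasDerivAt_id s).const_sub 1).pow 3).div ((hasDerivAt_id s).const_add 1) h1).pow 2
      using 1
    simp
    field_simp
    ring
  have hψ : ∀ s ∈ Ico (0 : ℝ) 1, HasDerivAt (fun s : ℝ => ‖deriv f (s * e)‖ ^ 2 * W s)
      (2 * inner ℝ (deriv f (s * e)) (deriv (deriv f) (s * e) * e) * W s +
        ‖deriv f (s * e)‖ ^ 2 * (-2 * (4 + 2 * s) * (1 - s) ^ 5 / (1 + s) ^ 3)) s :=
    fun s hs => (hd s hs).norm_sq.mul (hWd s hs)
  have hnonpos : ∀ s ∈ Ico (0 : ℝ) 1,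
      2 * inner ℝ (deriv f (s * e)) (deriv (deriv f) (s * e) * e) * W s +
        ‖deriv f (s * e)‖ ^ 2 * (-2 * (4 + 2 * s) * (1 - s) ^ 5 / (1 + s) ^ 3) ≤ 0 := by
    intro s hs
    have hs1 : 0 < 1 - s := by linarith [hs.2]
    have hs2 : 0 < 1 + s := by linarith [hs.1]
    have h1 := norm_deriv_deriv_sub_le_of_injOn hf hinj (a := s * e)
      (by rw [hnorm s hs.1]; exact hs.2)
    rw [hnorm s hs.1] at h1
    have h2 : ‖(1 - (s : ℂ) ^ 2) * deriv (deriv f) (s * e)‖ ≤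
        (4 + 2 * s) * ‖deriv f (s * e)‖ := by
      have h3 : ‖2 * conj ((s : ℂ) * e) * deriv f (s * e)‖ = 2 * s * ‖deriv f (s * e)‖ := by
        rw [norm_mul, norm_mul, RCLike.norm_conj, hnorm s hs.1, Complex.norm_ofNat]
      linarith [norm_le_norm_add_norm_sub' ((1 - (s : ℂ) ^ 2) * deriv (deriv f) (s * e))
        (2 * conj ((s : ℂ) * e) * deriv f (s * e))]
    have h4 : ‖1 - (s : ℂ) ^ 2‖ = (1 - s) * (1 + s) := by
      rw [← Complex.norm_of_nonneg (mul_pos hs1 hs2).le]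
      push_cast
      ring_nf
    rw [norm_mul, h4] at h2
    have h5 : inner ℝ (deriv f (s * e)) (deriv (deriv f) (s * e) * e) ≤
        ‖deriv f (s * e)‖ * ‖deriv (deriv f) (s * e)‖ := by
      have := real_inner_le_norm (deriv f (s * e)) (deriv (deriv f) (s * e) * e)
      rwa [norm_mul, hen, mul_one] at this
    have h6 : inner ℝ (deriv f (s * e)) (deriv (deriv f) (s * e) * e) * ((1 - s) * (1 + s)) ≤
        ‖deriv f (s * e)‖ ^ 2 * (4 + 2 * s) := by
      nlinarith [mul_le_mul_of_nonneg_right h5 (mul_pos hs1 hs2).le,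
        mul_le_mul_of_nonneg_left h2 (norm_nonneg (deriv f (s * e)))]
    have h7 : 2 * inner ℝ (deriv f (s * e)) (deriv (deriv f) (s * e) * e) * W s +
        ‖deriv f (s * e)‖ ^ 2 * (-2 * (4 + 2 * s) * (1 - s) ^ 5 / (1 + s) ^ 3) =
        2 * (1 - s) ^ 5 / (1 + s) ^ 3 *
        (inner ℝ (deriv f (s * e)) (deriv (deriv f) (s * e) * e) * ((1 - s) * (1 + s)) -
          ‖deriv f (s * e)‖ ^ 2 * (4 + 2 * s)) := by
      rw [hW]
      field_simp
      ring
    rw [h7]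
    exact mul_nonpos_of_nonneg_of_nonpos (by positivity) (by linarith)
  have hanti : AntitoneOn (fun s : ℝ => ‖deriv f (s * e)‖ ^ 2 * W s) (Ico 0 1) := by
    refine antitoneOn_of_deriv_nonpos (convex_Ico 0 1)
      (fun s hs => (hψ s hs).continuousAt.continuousWithinAt) (fun s hs => ?_) (fun s hs => ?_)
    · exact (hψ s (interior_subset hs)).differentiableAt.differentiableWithinAt
    · rw [(hψ s (interior_subset hs)).deriv]
      exact hnonpos s (interior_subset hs)
  have hle := hanti ⟨le_rfl, one_pos⟩ ⟨hzn.le, hz⟩ hzn.le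
  simp only [hze, hW, ofReal_zero, zero_mul, sub_zero, add_zero, one_pow, div_one, mul_one,
    ← mul_pow] at hle
  have hz1 : 0 < 1 - ‖z‖ := by linarith
  have h1 := (sq_le_sq₀ (by positivity) (norm_nonneg _)).1 hle
  rw [← le_div_iff₀ (by positivity), div_div_eq_mul_div] at h1
  rwa [mul_div_assoc] at h1

/-- The upper bound of the **Koebe growth theorem**. -/
theorem norm_le_of_injOn {f : ℂ → ℂ} (hf : DifferentiableOn ℂ f (ball 0 1))
    (hinj : InjOn f (ball 0 1)) (hf0 : f 0 = 0) {z : ℂ} (hz : ‖z‖ < 1) :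
    ‖f z‖ ≤ ‖deriv f 0‖ * (‖z‖ / (1 - ‖z‖) ^ 2) := by
  have hd : ∀ s ∈ Icc (0 : ℝ) 1, HasDerivAt (fun s : ℝ => f (s * z)) (deriv f (s * z) * z) s := by
    intro s hs
    have h1 : ((s : ℂ) * z) ∈ ball (0 : ℂ) 1 := by
      rw [mem_ball_zero_iff, norm_mul, Complex.norm_of_nonneg hs.1]
      nlinarith [hs.2, norm_nonneg z]
    have h2 := (hf.differentiableAt (isOpen_ball.mem_nhds h1)).hasDerivAt
    have h3 : HasDerivAt (fun s : ℝ => (s : ℂ) * z) z s := by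
      simpa using (ofRealCLM.hasDerivAt (x := s)).mul_const z
    exact h2.comp s h3
  have hB : ∀ s ∈ Icc (0 : ℝ) 1,
      HasDerivAt (fun s : ℝ => ‖deriv f 0‖ * (s * ‖z‖ / (1 - s * ‖z‖) ^ 2))
        (‖deriv f 0‖ * ((1 + s * ‖z‖) / (1 - s * ‖z‖) ^ 3) * ‖z‖) s := by
    intro s hs
    have h1 : 1 - s * ‖z‖ ≠ 0 := by nlinarith [hs.1, hs.2, norm_nonneg z]
    convert! ((((hasDerivAt_id s).mul_const ‖z‖)).div
      ((((hasDerivAt_id s).mul_const ‖z‖).const_sub 1).pow 2) (pow_ne_zero 2 h1)).const_mul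
        ‖deriv f 0‖ using 1
    simp
    field_simp
    ring
  have := image_norm_le_of_norm_deriv_right_le_deriv_boundary' (a := 0) (b := 1)
    (f := fun s : ℝ => f (s * z)) (f' := fun s : ℝ => deriv f (s * z) * z)
    (B := fun s : ℝ => ‖deriv f 0‖ * (s * ‖z‖ / (1 - s * ‖z‖) ^ 2))
    (B' := fun s : ℝ => ‖deriv f 0‖ * ((1 + s * ‖z‖) / (1 - s * ‖z‖) ^ 3) * ‖z‖)
    (fun s hs => (hd s hs).continuousAt.continuousWithinAt)
    (fun s hs => (hd s (Ico_subset_Icc_self hs)).hasDerivWithinAt) (by simp [hf0])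
    (fun s hs => (hB s hs).continuousAt.continuousWithinAt)
    (fun s hs => (hB s (Ico_subset_Icc_self hs)).hasDerivWithinAt) (by
      intro s hs
      have h1 : ‖(s : ℂ) * z‖ = s * ‖z‖ := by rw [norm_mul, Complex.norm_of_nonneg hs.1]
      rw [norm_mul, ← h1]
      refine mul_le_mul_of_nonneg_right (norm_deriv_le_of_injOn hf hinj ?_) (norm_nonneg z)
      rw [h1]
      nlinarith [hs.1, hs.2, norm_nonneg z])
    (right_mem_Icc.2 zero_le_one)
  simpa using this

/-- **Koebe-type growth estimate.** If `g` is injective and holomorphic on the open disk of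
radius `2R` centered at `0` with `g 0 = 0`, then `‖g z‖ ≤ 4 · ‖g′(0)‖ · ‖z‖` whenever
`‖z‖ ≤ R`. -/
theorem koebe_growth_estimate (R : ℝ) (hR : 0 < R) (g : ℂ → ℂ)
    (hg : DifferentiableOn ℂ g (ball (0 : ℂ) (2 * R)))
    (hinj : InjOn g (ball (0 : ℂ) (2 * R)))
    (hg0 : g 0 = 0) :
    ∀ z : ℂ, ‖z‖ ≤ R → ‖g z‖ ≤ 4 * ‖deriv g 0‖ * ‖z‖ := by
  intro z hz
  have h2R : ((2 * R : ℝ) : ℂ) ≠ 0 := by exact_mod_cast (by positivity : 2 * R ≠ 0)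
  have hnorm : ‖((2 * R : ℝ) : ℂ)‖ = 2 * R := Complex.norm_of_nonneg (by positivity)
  have hmaps : MapsTo (fun w : ℂ => ((2 * R : ℝ) : ℂ) * w) (ball 0 1) (ball 0 (2 * R)) := by
    intro w hw
    rw [mem_ball_zero_iff] at hw ⊢
    rw [norm_mul, hnorm]
    nlinarith
  have hw : ‖z / ((2 * R : ℝ) : ℂ)‖ ≤ 1 / 2 := by
    rw [norm_div, hnorm, div_le_div_iff₀ (by positivity) two_pos]
    linarith
  have hd : deriv (fun w : ℂ => g (((2 * R : ℝ) : ℂ) * w)) 0 = ((2 * R : ℝ) : ℂ) * deriv g 0 := by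
    rw [deriv_comp_mul_left, mul_zero, smul_eq_mul]
  have key := norm_le_of_injOn (f := fun w => g (((2 * R : ℝ) : ℂ) * w))
    (hg.comp (by fun_prop) hmaps)
    (hinj.comp (mul_right_injective₀ h2R).injOn hmaps) (by simp [hg0])
    (z := z / ((2 * R : ℝ) : ℂ)) (by linarith)
  rw [mul_div_cancel₀ z h2R, hd, norm_mul, hnorm] at key
  refine key.trans ?_
  have h1 : ‖z / ((2 * R : ℝ) : ℂ)‖ / (1 - ‖z / ((2 * R : ℝ) : ℂ)‖) ^ 2 ≤
      4 * ‖z / ((2 * R : ℝ) : ℂ)‖ := by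
    have hpos : 0 < 1 - ‖z / ((2 * R : ℝ) : ℂ)‖ := by linarith
    rw [div_le_iff₀ (by positivity)]
    nlinarith [norm_nonneg (z / ((2 * R : ℝ) : ℂ)),
      mul_nonneg (norm_nonneg (z / ((2 * R : ℝ) : ℂ)))
        (by nlinarith : 0 ≤ 4 * (1 - ‖z / ((2 * R : ℝ) : ℂ)‖) ^ 2 - 1)]
  refine (mul_le_mul_of_nonneg_left h1 (by positivity)).trans_eq ?_
  rw [norm_div, hnorm]
  field_simp
end

section
/- Let Ω ⊆ ℂ be a bounded open set with 0 ∈ Ω such that every straight (real) line through the origin intersects the topological frontier of Ω in exactly two points. Then Ω is star-shaped with respect to the origin: for every z ∈ Ω the closed segment from 0 to z is contained in Ω. -/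
open Set

/-- If `a • z` lies in the open set `Ω` and `b • z` does not, some `c • z` with `c ≠ a` between them
lies on the frontier of `Ω`. -/
theorem exists_smul_mem_frontier_of_mem_of_notMem {E : Type*} [TopologicalSpace E]
    [AddCommGroup E] [Module ℝ E] [ContinuousSMul ℝ E] {Ω : Set E} (hopen : IsOpen Ω) {z : E}
    {a b : ℝ} (ha : a • z ∈ Ω) (hb : b • z ∉ Ω) :
    ∃ c ∈ uIcc a b, c ≠ a ∧ c • z ∈ frontier Ω := by
  by_contra! hno
  have hcont : Continuous fun t : ℝ => t • z := by fun_prop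
  have hcover : ∀ c ∈ uIcc a b, c • z ∈ Ω ∨ c • z ∈ (closure Ω)ᶜ := by
    intro c hc
    by_contra! h
    have hca : c ≠ a := by
      rintro rfl
      exact h.1 ha
    refine hno c hc hca ?_
    rw [hopen.frontier_eq]
    exact ⟨not_not.mp h.2, h.1⟩
  obtain ⟨c, -, hc, hc'⟩ := isPreconnected_uIcc ((fun t : ℝ => t • z) ⁻¹' Ω)
    ((fun t : ℝ => t • z) ⁻¹' (closure Ω)ᶜ) (hopen.preimage hcont)
    (isClosed_closure.isOpen_compl.preimage hcont) hcover ⟨a, left_mem_uIcc, ha⟩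
    ⟨b, right_mem_uIcc, (hcover b right_mem_uIcc).resolve_left hb⟩
  exact hc' (subset_closure hc)

/-- **Star-shapedness criterion.** If `Ω ⊆ ℂ` is a bounded open set containing `0` such that
every straight real line through the origin meets the frontier of `Ω` in exactly two points,
then `Ω` is star-shaped with respect to the origin. -/
theorem star_shaped_of_two_point_boundary_lines (Ω : Set ℂ)
    (hopen : IsOpen Ω) (hbd : Bornology.IsBounded Ω) (h0 : (0 : ℂ) ∈ Ω)
    (hlines : ∀ v : ℂ, v ≠ 0 →
      ∃ a b : ℂ, a ≠ b ∧ frontier Ω ∩ {z : ℂ | ∃ t : ℝ, z = t • v} = {a, b}) :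
    ∀ z ∈ Ω, segment ℝ (0 : ℂ) z ⊆ Ω := by
  intro z hz w hw
  by_contra hwΩ
  rw [segment_eq_image] at hw
  obtain ⟨t, ⟨ht0, ht1⟩, rfl⟩ := hw
  simp only [smul_zero, zero_add] at hwΩ
  have hz0 : z ≠ 0 := by
    rintro rfl
    exact hwΩ (by simpa using h0)
  have hzpos : 0 < ‖z‖ := norm_pos_iff.mpr hz0
  obtain ⟨R, hR⟩ := hbd.subset_closedBall (0 : ℂ)
  obtain ⟨T, hT1, hT⟩ : ∃ T : ℝ, 1 < T ∧ R < T * ‖z‖ := by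
    refine ⟨|R| / ‖z‖ + 2, by linarith [div_nonneg (abs_nonneg R) hzpos.le], ?_⟩
    rw [add_mul, div_mul_cancel₀ _ hzpos.ne']
    linarith [le_abs_self R]
  have hout : ∀ s : ℝ, |s| = T → s • z ∉ Ω := by
    intro s hs hmem
    have := hR hmem
    rw [mem_closedBall_zero_iff, norm_smul, Real.norm_eq_abs, hs] at this
    linarith
  have h0' : (0 : ℝ) • z ∈ Ω := by simpa using h0
  have h1' : (1 : ℝ) • z ∈ Ω := by simpa using hz
  have ht1' : t < 1 := ht1.lt_of_ne (by rintro rfl; exact hwΩ h1')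
  obtain ⟨p, hp, hp0, hpf⟩ := exists_smul_mem_frontier_of_mem_of_notMem hopen h0' hwΩ
  obtain ⟨q, hq, hq1, hqf⟩ := exists_smul_mem_frontier_of_mem_of_notMem hopen h1'
    (hout T (abs_of_pos (by linarith)))
  obtain ⟨r, hr, hr0, hrf⟩ := exists_smul_mem_frontier_of_mem_of_notMem hopen h0'
    (hout (-T) (by rw [abs_neg, abs_of_pos (by linarith)]))
  rw [uIcc_of_le ht0] at hp
  rw [uIcc_of_le hT1.le] at hq
  rw [uIcc_of_ge (by linarith)] at hr
  have hrneg : r < 0 := hr.2.lt_of_ne hr0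
  have hppos : 0 < p := hp.1.lt_of_ne hp0.symm
  have hpq : p < q := by linarith [hp.2, hq.1]
  have hinj := smul_left_injective ℝ hz0
  have hne₁ : p • z ≠ q • z := fun h => hpq.ne (hinj h)
  have hne₂ : r • z ≠ p • z := fun h => (hrneg.trans hppos).ne (hinj h)
  have hne₃ : r • z ≠ q • z := fun h => (hrneg.trans (hppos.trans hpq)).ne (hinj h)
  obtain ⟨a, b, -, hab⟩ := hlines z hz0
  have hmem : ∀ s : ℝ, s • z ∈ frontier Ω → s • z = a ∨ s • z = b := fun s hs => by
    have : s • z ∈ frontier Ω ∩ {z' : ℂ | ∃ t : ℝ, z' = t • z} := ⟨hs, s, rfl⟩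
    rwa [hab] at this
  grind [hmem p hpf, hmem q hqf, hmem r hrf]
end
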